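/- arXiv:math/0703083 — 10 statements merged into one kernel-verified Lean document; each statement's English description precedes it below -/
import Mathlib

section
/- Let r be a positive integer and suppose 1̲, v₁, …, v_k ∈ 𝒱_{2r} are linearly independent over 𝔽₂ and satisfy vᵢ∘vⱼ ∈ 𝒱_{2r} for all i, j ∈ {1,…,k}. Then k ≤ r−1. -/
/-- The subspace 𝒱_n = {x ∈ (𝔽₂)^n : Σ xᵢ = 0}. -/
def VS (n : ℕ) : Submodule (ZMod 2) (Fin n → ZMod 2) where
  carrier := {x | ∑ i, x i = 0}
  add_mem' := by
    intro a b ha hb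
    simp only [Set.mem_setOf_eq] at *
    simp [Finset.sum_add_distrib, ha, hb]
  zero_mem' := by simp
  smul_mem' := by
    intro c x hx
    simp only [Set.mem_setOf_eq, Pi.smul_apply, ← Finset.mul_sum, smul_eq_mul] at *
    simp [hx]

lemma mem_VS {n : ℕ} (x : Fin n → ZMod 2) : x ∈ VS n ↔ ∑ i, x i = 0 := Iff.rfl

/-- 𝒱(v) = {x ∈ 𝒱_n : x∘v ∈ 𝒱_n}. -/
def VV {n : ℕ} (v : Fin n → ZMod 2) : Submodule (ZMod 2) (Fin n → ZMod 2) where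
  carrier := {x | x ∈ VS n ∧ x * v ∈ VS n}
  add_mem' := by
    intro a b ha hb
    exact ⟨(VS n).add_mem ha.1 hb.1, by rw [add_mul]; exact (VS n).add_mem ha.2 hb.2⟩
  zero_mem' := ⟨(VS n).zero_mem, by rw [zero_mul]; exact (VS n).zero_mem⟩
  smul_mem' := by
    intro c x hx
    exact ⟨(VS n).smul_mem c hx.1, by rw [smul_mul_assoc]; exact (VS n).smul_mem c hx.2⟩

lemma mem_VV {n : ℕ} (v x : Fin n → ZMod 2) : x ∈ VV v ↔ x ∈ VS n ∧ x * v ∈ VS n := Iff.rfl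

/-- if 1̲, v₁, …, v_k ∈ 𝒱_{2r} are linearly independent over 𝔽₂ and
vᵢ∘vⱼ ∈ 𝒱_{2r} for all i, j, then k ≤ r − 1. -/
theorem stmt6 (r k : ℕ) (hr : 0 < r)
    (v : Fin k → Fin (2*r) → ZMod 2) (hvV : ∀ i, v i ∈ VS (2*r))
    (hli : LinearIndependent (ZMod 2)
      (Fin.cons (1 : Fin (2*r) → ZMod 2) v : Fin (k+1) → Fin (2*r) → ZMod 2))
    (hprod : ∀ i j, v i * v j ∈ VS (2*r)) :
    k ≤ r - 1 := by
  set A : Matrix (Fin (k+1)) (Fin (2*r)) (ZMod 2) :=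
    (Fin.cons (1 : Fin (2*r) → ZMod 2) v : Fin (k+1) → Fin (2*r) → ZMod 2) with hA
  have hrank : A.rank = k + 1 := by
    simpa using LinearIndependent.rank_matrix (M := A) hli
  have h2 : (2 : ZMod 2) = 0 := by decide
  have hmul : A * A.transpose = 0 := by
    ext i j
    rw [Matrix.mul_apply]
    simp only [Matrix.transpose_apply, Matrix.zero_apply]
    refine Fin.cases ?_ (fun i => ?_) i <;> refine Fin.cases ?_ (fun j => ?_) j
    · simp [hA, h2]
    · simpa [hA] using (mem_VS _).1 (hvV j)
    · simpa [hA] using (mem_VS _).1 (hvV i)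
    · simpa [hA] using (mem_VS _).1 (hprod i j)
  have h := Matrix.rank_add_rank_le_card_of_mul_eq_zero hmul
  rw [Matrix.rank_transpose, hrank] at h
  simp at h
  omega
end

section
/- Let r be a positive integer and let σ : (𝔽₂)^{2r} → (𝔽₂)^{2r} be an invertible linear map such that σ(𝒱_{2r}) = 𝒱_{2r} and σ(x∘y) = σ(x)∘σ(y) for all x, y ∈ 𝒱_{2r}. Then σ is a coordinate permutation: there exists a permutation π of {1,…,2r} such that σ(x) = (x_{π(1)},…,x_{π(2r)}) for all x ∈ (𝔽₂)^{2r}. Consequently the group 𝒲_{2r} of all such maps is isomorphic to the symmetric group S_{2r}. -/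
/-- The defining property of elements of 𝒲_n: an invertible linear map of (𝔽₂)^n with
σ(𝒱_n) = 𝒱_n which is multiplicative on 𝒱_n. -/
def IsW {n : ℕ} (σ : (Fin n → ZMod 2) ≃ₗ[ZMod 2] (Fin n → ZMod 2)) : Prop :=
  Submodule.map (σ : (Fin n → ZMod 2) →ₗ[ZMod 2] (Fin n → ZMod 2)) (VS n) = VS n ∧
    ∀ x ∈ VS n, ∀ y ∈ VS n, σ (x * y) = σ x * σ y

lemma IsW.mem_iff {n : ℕ} {σ : (Fin n → ZMod 2) ≃ₗ[ZMod 2] (Fin n → ZMod 2)}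
    (h : IsW σ) (x : Fin n → ZMod 2) : σ x ∈ VS n ↔ x ∈ VS n := by
  constructor
  · intro hx
    rw [← h.1] at hx
    obtain ⟨y, hy, hyx⟩ := hx
    simpa [σ.injective hyx] using hy
  · intro hx
    rw [← h.1]
    exact ⟨x, hx, rfl⟩

/-- The group 𝒲_n of invertible linear maps σ of (𝔽₂)^n with σ(𝒱_n) = 𝒱_n and
σ(x∘y) = σ(x)∘σ(y) for all x, y ∈ 𝒱_n. -/
def Wgrp (n : ℕ) : Subgroup ((Fin n → ZMod 2) ≃ₗ[ZMod 2] (Fin n → ZMod 2)) where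
  carrier := {σ | IsW σ}
  one_mem' := by
    refine ⟨?_, fun x _ y _ => rfl⟩
    simp [Submodule.map_id (VS n)]
  mul_mem' := by
    intro σ τ hσ hτ
    constructor
    · have : ((σ * τ : (Fin n → ZMod 2) ≃ₗ[ZMod 2] (Fin n → ZMod 2)) :
          (Fin n → ZMod 2) →ₗ[ZMod 2] (Fin n → ZMod 2)) =
          (σ : (Fin n → ZMod 2) →ₗ[ZMod 2] (Fin n → ZMod 2)).comp
            (τ : (Fin n → ZMod 2) →ₗ[ZMod 2] (Fin n → ZMod 2)) := rfl
      rw [this, Submodule.map_comp, hτ.1, hσ.1]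
    · intro x hx y hy
      have hτx : τ x ∈ VS n := (hτ.mem_iff x).2 hx
      have hτy : τ y ∈ VS n := (hτ.mem_iff y).2 hy
      have : (σ * τ) (x * y) = σ (τ (x * y)) := rfl
      rw [this, hτ.2 x hx y hy, hσ.2 _ hτx _ hτy]; rfl
  inv_mem' := by
    intro σ hσ
    constructor
    · apply le_antisymm
      · rintro z ⟨x, hx, rfl⟩
        show σ.symm x ∈ VS n
        rw [← (hσ.mem_iff (σ.symm x)), σ.apply_symm_apply]
        exact hx
      · intro x hx
        refine ⟨σ x, (hσ.mem_iff x).2 hx, ?_⟩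
        show σ.symm (σ x) = x
        exact σ.symm_apply_apply x
    · intro x hx y hy
      have hx' : σ.symm x ∈ VS n := by
        rw [← (hσ.mem_iff (σ.symm x)), σ.apply_symm_apply]; exact hx
      have hy' : σ.symm y ∈ VS n := by
        rw [← (hσ.mem_iff (σ.symm y)), σ.apply_symm_apply]; exact hy
      show σ.symm (x * y) = σ.symm x * σ.symm y
      apply σ.injective
      rw [σ.apply_symm_apply, hσ.2 _ hx' _ hy', σ.apply_symm_apply, σ.apply_symm_apply]

lemma fun_perm_of_isW (n : ℕ)
    (σ : (Fin n → ZMod 2) ≃ₗ[ZMod 2] (Fin n → ZMod 2)) (h : IsW σ) :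
    ∃ π : Equiv.Perm (Fin n), ∀ (x : Fin n → ZMod 2) (i : Fin n), σ x i = x (π i) := by
  have hpair : ∀ i j : Fin n, (Pi.single i 1 + Pi.single j 1 : Fin n → ZMod 2) ∈ VS n := by
    intro i j
    rw [mem_VS]
    simp only [Pi.add_apply, Finset.sum_add_distrib, Finset.sum_pi_single', Finset.mem_univ,
      if_true]
    decide
  have hz : ∀ a : ZMod 2, a ≠ 0 → a = 1 := by decide
  -- expansion
  have hexp : ∀ (x : Fin n → ZMod 2) (k : Fin n),
      σ x k = ∑ i, x i * σ (Pi.single i 1) k := by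
    intro x k
    have hx : x = ∑ i, x i • (Pi.single i 1 : Fin n → ZMod 2) := by
      ext j
      simp [Finset.sum_apply, Pi.single_apply]
    conv_lhs => rw [hx]
    simp [Finset.sum_apply]
  have hex : ∀ k, ∃ i, ∀ x : Fin n → ZMod 2, σ x k = x i := by
    intro k
    have hne : ∃ i, σ (Pi.single i 1) k ≠ 0 := by
      by_contra! hc
      have h1 := hexp (σ.symm (Pi.single k 1)) k
      simp [hc] at h1
    obtain ⟨i, hi⟩ := hne
    have hi1 := hz _ hi
    refine ⟨i, fun x => ?_⟩
    have hzero : ∀ j, j ≠ i → σ (Pi.single j 1) k = 0 := by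
      intro j hj
      by_contra hj0
      have hj1 := hz _ hj0
      by_cases hk : ∃ l, l ≠ i ∧ l ≠ j
      · obtain ⟨l, hli, hlj⟩ := hk
        have hm := h.2 _ (hpair i j) _ (hpair i l)
        have hp : (Pi.single i 1 + Pi.single j 1 : Fin n → ZMod 2) *
            (Pi.single i 1 + Pi.single l 1) = Pi.single i 1 := by
          ext m
          simp only [Pi.mul_apply, Pi.add_apply, Pi.single_apply]
          by_cases h1 : m = i
          · subst h1; simp [hj.symm, hli.symm]
          · by_cases h2 : m = j
            · subst h2; simp [h1, hlj.symm]
            · simp [h1, h2]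
        rw [hp] at hm
        have hm' := congrFun hm k
        simp only [map_add, Pi.mul_apply, Pi.add_apply, hi1, hj1] at hm'
        rw [show (1 : ZMod 2) + 1 = 0 by decide, zero_mul] at hm'
        exact one_ne_zero hm'
      · push Not at hk
        have hone : (1 : Fin n → ZMod 2) = Pi.single i 1 + Pi.single j 1 := by
          ext m
          simp only [Pi.one_apply, Pi.add_apply, Pi.single_apply]
          by_cases h1 : m = i
          · subst h1; simp [hj.symm]
          · simp [hk m h1, hj]
        have h1V : (1 : Fin n → ZMod 2) ∈ VS n := hone ▸ hpair i j
        obtain ⟨k', hk'⟩ : ∃ k', k' ≠ k := by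
          by_cases hki : k = i
          · exact ⟨j, by rw [hki]; exact hj⟩
          · exact ⟨i, fun h => hki h.symm⟩
        have hmem : σ.symm (Pi.single k 1 + Pi.single k' 1) ∈ VS n := by
          rw [← h.mem_iff, σ.apply_symm_apply]; exact hpair _ _
        have hm := congrFun (h.2 _ h1V _ hmem) k
        rw [one_mul, σ.apply_symm_apply, hone] at hm
        simp only [map_add, Pi.mul_apply, Pi.add_apply, hi1, hj1] at hm
        rw [show (1 : ZMod 2) + 1 = 0 by decide, zero_mul] at hm
        simp [hk'.symm] at hm
    rw [hexp, Finset.sum_eq_single i]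
    · rw [hi1, mul_one]
    · intro j _ hj
      rw [hzero j hj, mul_zero]
    · simp
  choose p hp using hex
  have hinj : Function.Injective p := by
    intro k l hkl
    by_contra hne
    have h1 := hp k (σ.symm (Pi.single k 1))
    have h2 := hp l (σ.symm (Pi.single k 1))
    rw [hkl, ← h2] at h1
    simp [Ne.symm hne] at h1
  exact ⟨Equiv.ofBijective p (Finite.injective_iff_bijective.1 hinj), fun x i => hp i x⟩

lemma isW_perm {n : ℕ} (π : Equiv.Perm (Fin n)) :
    IsW (LinearEquiv.funCongrLeft (ZMod 2) (ZMod 2) π) := by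
  have key : ∀ (π : Equiv.Perm (Fin n)) (x : Fin n → ZMod 2), x ∈ VS n →
      (fun i => x (π i)) ∈ VS n := by
    intro π x hx
    rw [mem_VS] at *
    rw [← hx]
    exact Equiv.sum_comp π x
  refine ⟨le_antisymm ?_ ?_, fun x _ y _ => rfl⟩
  · rintro _ ⟨x, hx, rfl⟩
    exact key π x hx
  · intro x hx
    refine ⟨fun i => x (π.symm i), key π.symm x hx, ?_⟩
    ext i
    simp [LinearEquiv.funCongrLeft, LinearMap.funLeft]

/-- The action of permutations by coordinate permutations. -/
def permToW (n : ℕ) : Equiv.Perm (Fin n) →* Wgrp n where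
  toFun π := ⟨LinearEquiv.funCongrLeft (ZMod 2) (ZMod 2) π⁻¹, isW_perm _⟩
  map_one' := rfl
  map_mul' a b := by
    apply Subtype.ext
    apply LinearEquiv.ext
    intro x
    ext i
    rfl

theorem stmt7 (r : ℕ) (hr : 0 < r) :
    (∀ σ : (Fin (2*r) → ZMod 2) ≃ₗ[ZMod 2] (Fin (2*r) → ZMod 2), IsW σ →
      ∃ π : Equiv.Perm (Fin (2*r)), ∀ (x : Fin (2*r) → ZMod 2) (i : Fin (2*r)),
        σ x i = x (π i)) ∧
    Nonempty (Wgrp (2*r) ≃* Equiv.Perm (Fin (2*r))) := by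
  have main := fun_perm_of_isW (2*r)
  refine ⟨main, ⟨(MulEquiv.ofBijective (permToW (2*r)) ⟨?_, ?_⟩).symm⟩⟩
  · intro a b hab
    have h1 : ∀ (x : Fin (2*r) → ZMod 2) (i : Fin (2*r)), x (a⁻¹ i) = x (b⁻¹ i) := by
      intro x i
      exact congrFun (LinearEquiv.congr_fun (congrArg Subtype.val hab) x) i
    apply inv_injective
    ext i
    by_contra hne
    have h2 := h1 (Pi.single (a⁻¹ i) 1) i
    rw [Pi.single_eq_same, Pi.single_eq_of_ne (fun h => hne (by rw [h]))] at h2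
    exact one_ne_zero h2
  · rintro ⟨σ, hσ⟩
    obtain ⟨π, hπ⟩ := main σ hσ
    refine ⟨π⁻¹, ?_⟩
    apply Subtype.ext
    apply LinearEquiv.ext
    intro x
    ext i
    rw [hπ]
    rfl
end

section
/- Let n ≥ 2 and r ≥ 1 be integers. For j = 1, 2 let V₀ʲ ⊆ V₁ʲ ⊆ ⋯ ⊆ V_{n−1}ʲ = 𝒱_{2r} be chains of subspaces of (𝔽₂)^{2r} with V₀ʲ = Span{1̲} and u∘v ∈ V_{i+i'}ʲ whenever u ∈ Vᵢʲ, v ∈ V_{i'}ʲ and i+i' ≤ n−1, and let Rⱼ = V₀ʲ + V₁ʲt + ⋯ + V_{n−1}ʲt^{n−1} + (𝔽₂)^{2r}(tⁿ+⋯) be the corresponding graded subring of ((𝔽₂)^{2r})[t]. Suppose f : R₁ → R₂ is a ring isomorphism preserving the grading, i.e. for each i ≥ 0, f maps the degree-i homogeneous component of R₁ bijectively onto the degree-i homogeneous component of R₂. Then there exists σ ∈ 𝒲_{2r} such that f = Σ_{i=0}^{∞} σ tⁱ, i.e. f(Σᵢ vᵢtⁱ) = Σᵢ σ(vᵢ)tⁱ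 for every element Σᵢ vᵢtⁱ ∈ R₁. -/
/-- A polynomial is homogeneous of degree i if all its other coefficients vanish. -/
def IsHomog {R : Type*} [Semiring R] (i : ℕ) (p : Polynomial R) : Prop :=
  ∀ j, j ≠ i → p.coeff j = 0

/-- a grading-preserving ring isomorphism f : R₁ → R₂ between two such
graded subrings of ((𝔽₂)^{2r})[t] is of the form f = Σᵢ σ tⁱ for some σ ∈ 𝒲_{2r}. -/
theorem stmt9 (r n : ℕ) (hr : 0 < r) (hn : 2 ≤ n)
    (V₁ V₂ : ℕ → Submodule (ZMod 2) (Fin (2*r) → ZMod 2))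
    (hchain₁ : ∀ i, i + 1 ≤ n - 1 → V₁ i ≤ V₁ (i+1))
    (hchain₂ : ∀ i, i + 1 ≤ n - 1 → V₂ i ≤ V₂ (i+1))
    (h0₁ : V₁ 0 = Submodule.span (ZMod 2) {(1 : Fin (2*r) → ZMod 2)})
    (h0₂ : V₂ 0 = Submodule.span (ZMod 2) {(1 : Fin (2*r) → ZMod 2)})
    (htop₁ : V₁ (n-1) = VS (2*r)) (htop₂ : V₂ (n-1) = VS (2*r))
    (hmul₁ : ∀ i j u w, i + j ≤ n - 1 → u ∈ V₁ i → w ∈ V₁ j → u * w ∈ V₁ (i+j))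
    (hmul₂ : ∀ i j u w, i + j ≤ n - 1 → u ∈ V₂ i → w ∈ V₂ j → u * w ∈ V₂ (i+j))
    (S₁ S₂ : Subring (Polynomial (Fin (2*r) → ZMod 2)))
    (hS₁ : (S₁ : Set (Polynomial (Fin (2*r) → ZMod 2))) =
      {p : Polynomial (Fin (2*r) → ZMod 2) | ∀ i ≤ n - 1, p.coeff i ∈ V₁ i})
    (hS₂ : (S₂ : Set (Polynomial (Fin (2*r) → ZMod 2))) =
      {p : Polynomial (Fin (2*r) → ZMod 2) | ∀ i ≤ n - 1, p.coeff i ∈ V₂ i})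
    (f : S₁ ≃+* S₂)
    (hgrad : ∀ (i : ℕ) (p : S₁),
      IsHomog i (p : Polynomial (Fin (2*r) → ZMod 2)) ↔
        IsHomog i ((f p : S₂) : Polynomial (Fin (2*r) → ZMod 2))) :
    ∃ σ : (Fin (2*r) → ZMod 2) ≃ₗ[ZMod 2] (Fin (2*r) → ZMod 2), IsW σ ∧
      ∀ (p : S₁) (i : ℕ),
        ((f p : S₂) : Polynomial (Fin (2*r) → ZMod 2)).coeff i =
          σ ((p : Polynomial (Fin (2*r) → ZMod 2)).coeff i) := by
  classical
  have mem1 : ∀ p, p ∈ S₁ ↔ ∀ i ≤ n - 1, p.coeff i ∈ V₁ i := by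
    intro p; rw [← SetLike.mem_coe, hS₁]; rfl
  have mem2 : ∀ p, p ∈ S₂ ↔ ∀ i ≤ n - 1, p.coeff i ∈ V₂ i := by
    intro p; rw [← SetLike.mem_coe, hS₂]; rfl
  have one1 : (1 : Fin (2*r) → ZMod 2) ∈ V₁ 1 := by
    apply hchain₁ 0 (by omega)
    rw [h0₁]; exact Submodule.subset_span rfl
  have X1 : (Polynomial.X : Polynomial (Fin (2*r) → ZMod 2)) ∈ S₁ := by
    rw [mem1]; intro i _
    rw [Polynomial.coeff_X]
    split_ifs with h
    · subst h; exact one1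
    · exact Submodule.zero_mem _
  have mon1 : ∀ q : Polynomial (Fin (2*r) → ZMod 2), q * Polynomial.X ^ n ∈ S₁ := by
    intro q
    rw [mem1]; intro i hi
    rw [Polynomial.coeff_mul_X_pow', if_neg (by omega)]
    exact Submodule.zero_mem _
  have mon2 : ∀ q : Polynomial (Fin (2*r) → ZMod 2), q * Polynomial.X ^ n ∈ S₂ := by
    intro q
    rw [mem2]; intro i hi
    rw [Polynomial.coeff_mul_X_pow', if_neg (by omega)]
    exact Submodule.zero_mem _
  have homog : ∀ (i : ℕ) (p : Polynomial (Fin (2*r) → ZMod 2)), IsHomog i p →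
      p = Polynomial.C (p.coeff i) * Polynomial.X ^ i := by
    intro i p hp
    ext1 j
    rw [Polynomial.coeff_C_mul_X_pow]
    split_ifs with h
    · rw [h]
    · exact hp j h
  have homogC : ∀ (i : ℕ) (a : Fin (2*r) → ZMod 2),
      IsHomog i (Polynomial.C a * Polynomial.X ^ i) := by
    intro i a j hj
    rw [Polynomial.coeff_C_mul_X_pow, if_neg hj]
  -- the image of X
  have fX : ((f ⟨Polynomial.X, X1⟩ : S₂) : Polynomial (Fin (2*r) → ZMod 2)) = Polynomial.X := by
    have h1 := (hgrad 1 ⟨Polynomial.X, X1⟩).1 (by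
      have := homogC 1 1
      simpa using this)
    have h2 := homog _ _ h1
    obtain ⟨q, hq⟩ := f.surjective ⟨_, mon2 Polynomial.X⟩
    have h3 : IsHomog (n+1) (q : Polynomial (Fin (2*r) → ZMod 2)) := by
      rw [hgrad, hq]
      have := homogC (n+1) 1
      simpa [pow_succ'] using this
    have h4 := homog _ _ h3
    have h5 : q = ⟨_, mon1 (Polynomial.C ((q : Polynomial (Fin (2*r) → ZMod 2)).coeff (n+1)))⟩ *
        ⟨Polynomial.X, X1⟩ := by
      apply Subtype.ext
      rw [h4]
      simp [pow_succ, mul_assoc]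
    rw [h5, map_mul] at hq
    have h6 := congrArg (fun p : S₂ => (p : Polynomial (Fin (2*r) → ZMod 2)).coeff (n+1)) hq
    simp only [Subring.coe_mul] at h6
    rw [h2, pow_one, ← mul_assoc, Polynomial.coeff_mul_X, Polynomial.coeff_mul_C,
      ← pow_succ', Polynomial.coeff_X_pow, if_pos rfl] at h6
    have hc : ((f ⟨Polynomial.X, X1⟩ : S₂) : Polynomial (Fin (2*r) → ZMod 2)).coeff 1 = 1 := by
      funext j
      have h7 := congrFun h6 j
      rw [Pi.mul_apply] at h7
      have : ∀ a b : ZMod 2, a * b = 1 → b = 1 := by decide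
      exact this _ _ h7
    rw [h2, hc]; simp
  let F : Polynomial (Fin (2*r) → ZMod 2) →+ Polynomial (Fin (2*r) → ZMod 2) :=
    { toFun := fun q => ((f ⟨_, mon1 q⟩ : S₂) : Polynomial (Fin (2*r) → ZMod 2))
      map_zero' := by
        have : (⟨_, mon1 0⟩ : S₁) = 0 := Subtype.ext (by simp)
        rw [this]; simp
      map_add' := by
        intro a b
        have : (⟨_, mon1 (a+b)⟩ : S₁) = ⟨_, mon1 a⟩ + ⟨_, mon1 b⟩ :=
          Subtype.ext (by simp [add_mul])
        rw [this, map_add, Subring.coe_add] }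
  have hF : ∀ q, F q = ((f ⟨_, mon1 q⟩ : S₂) : Polynomial (Fin (2*r) → ZMod 2)) := fun _ => rfl
  let s : (Fin (2*r) → ZMod 2) →+ (Fin (2*r) → ZMod 2) :=
    { toFun := fun a => (F (Polynomial.C a)).coeff n
      map_zero' := by simp
      map_add' := by intro a b; simp }
  have hs : ∀ a, F (Polynomial.C a) = Polynomial.C (s a) * Polynomial.X ^ n := by
    intro a
    apply homog
    exact (hgrad n ⟨_, mon1 (Polynomial.C a)⟩).1 (homogC n a)
  have Fmon : ∀ k a, F (Polynomial.C a * Polynomial.X ^ k) =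
      Polynomial.C (s a) * Polynomial.X ^ (n + k) := by
    intro k a
    have : (⟨_, mon1 (Polynomial.C a * Polynomial.X ^ k)⟩ : S₁) =
        ⟨_, mon1 (Polynomial.C a)⟩ * ⟨Polynomial.X, X1⟩ ^ k :=
      Subtype.ext (by simp only [Subring.coe_mul, Subring.coe_pow]; ring)
    rw [hF, this, map_mul, map_pow, Subring.coe_mul, Subring.coe_pow, fX, ← hF, hs, pow_add,
      mul_assoc]
  have Fco : ∀ q i, (F q).coeff (i + n) = s (q.coeff i) := by
    intro q i
    induction q using Polynomial.induction_on' with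
    | add p q hp hq => rw [map_add, Polynomial.coeff_add, hp, hq, Polynomial.coeff_add, map_add]
    | monomial k a =>
      rw [← Polynomial.C_mul_X_pow_eq_monomial, Fmon, Polynomial.coeff_C_mul_X_pow,
        Polynomial.coeff_C_mul_X_pow]
      by_cases h : i = k
      · rw [if_pos h, if_pos (by omega)]
      · rw [if_neg h, if_neg (by omega), map_zero]
  have key : ∀ (p : S₁) (i : ℕ), ((f p : S₂) : Polynomial (Fin (2*r) → ZMod 2)).coeff i =
      s ((p : Polynomial (Fin (2*r) → ZMod 2)).coeff i) := by
    intro p i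
    have : (⟨_, mon1 p⟩ : S₁) = p * ⟨Polynomial.X, X1⟩ ^ n :=
      Subtype.ext (by simp only [Subring.coe_mul, Subring.coe_pow])
    rw [← Fco, hF, this, map_mul, map_pow, Subring.coe_mul, Subring.coe_pow, fX,
      Polynomial.coeff_mul_X_pow]
  have smul : ∀ x y, s (x * y) = s x * s y := by
    intro x y
    have h := key (⟨_, mon1 (Polynomial.C x)⟩ * ⟨_, mon1 (Polynomial.C y)⟩) (n + n)
    rw [map_mul, Subring.coe_mul, ← hF, ← hF, hs, hs, Subring.coe_mul] at h
    have e : ∀ u v : Fin (2*r) → ZMod 2, (Polynomial.C u * Polynomial.X ^ n) *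
        (Polynomial.C v * Polynomial.X ^ n) = Polynomial.C (u * v) * Polynomial.X ^ (n + n) := by
      intro u v; rw [Polynomial.C_mul]; ring
    rw [e, e, Polynomial.coeff_C_mul_X_pow, Polynomial.coeff_C_mul_X_pow, if_pos rfl,
      if_pos rfl] at h
    exact h.symm
  have sinj : Function.Injective (s.toZModLinearMap 2) := by
    rw [injective_iff_map_eq_zero]
    intro a ha
    have ha' : s a = 0 := ha
    have h := hs a
    rw [ha', Polynomial.C_0, zero_mul, hF] at h
    have h2 : f ⟨_, mon1 (Polynomial.C a)⟩ = 0 := Subtype.ext h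
    rw [map_eq_zero_iff f f.injective] at h2
    have h3 := congrArg (fun p : S₁ => (p : Polynomial (Fin (2*r) → ZMod 2)).coeff n) h2
    simpa using h3
  refine ⟨LinearEquiv.ofInjectiveEndo _ sinj, ⟨?_, fun x _ y _ => smul x y⟩, key⟩
  apply Submodule.eq_of_le_of_finrank_eq
  · rintro _ ⟨x, hx, rfl⟩
    have hm : Polynomial.C x * Polynomial.X ^ (n-1) ∈ S₁ := by
      rw [mem1]; intro i _
      rw [Polynomial.coeff_C_mul_X_pow]
      split_ifs with h
      · rw [h, htop₁]; exact hx
      · exact Submodule.zero_mem _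
    have h := key ⟨_, hm⟩ (n-1)
    have h2 := (mem2 _).1 (f ⟨_, hm⟩).2 (n-1) le_rfl
    rw [h, htop₂, Polynomial.coeff_C_mul_X_pow, if_pos rfl] at h2
    exact h2
  · exact LinearEquiv.finrank_map_eq _ _
end

section
/- Let n ≥ 2 and r ≥ 1 be integers. For j = 1, 2 let V₀ʲ ⊆ V₁ʲ ⊆ ⋯ ⊆ V_{n−1}ʲ = 𝒱_{2r} be chains of subspaces of (𝔽₂)^{2r} with V₀ʲ = Span{1̲} and u∘v ∈ V_{i+i'}ʲ whenever u ∈ Vᵢʲ, v ∈ V_{i'}ʲ and i+i' ≤ n−1, and let Rⱼ = V₀ʲ + V₁ʲt + ⋯ + V_{n−1}ʲt^{n−1} + (𝔽₂)^{2r}(tⁿ+⋯) be the corresponding graded subring of ((𝔽₂)^{2r})[t]. Then there exists a grading-preserving ring isomorphism between R₁ and R₂ if and only if there exists σ ∈ 𝒲_{2r} such that σ maps Vᵢ¹ isomorphically onto Vᵢ² for every i < n−1. -/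
open Polynomial in
lemma IsHomog.eq_monomial {R : Type*} [Semiring R] {i : ℕ} {p : Polynomial R} (h : IsHomog i p) :
    p = monomial i (p.coeff i) := by
  ext j
  rw [coeff_monomial]
  split_ifs with hj
  · rw [hj]
  · exact h j (Ne.symm hj)

open Polynomial in
lemma isHomog_monomial {R : Type*} [Semiring R] (i : ℕ) (x : R) : IsHomog i (monomial i x) := by
  intro j hj
  rw [coeff_monomial, if_neg (Ne.symm hj)]

/-- the vector supported on two coordinates -/
def pr2 {n : ℕ} (i j : Fin n) : Fin n → ZMod 2 := Pi.single i 1 + Pi.single j 1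

lemma pr2_mem {n : ℕ} (i j : Fin n) : pr2 i j ∈ VS n := by
  rw [mem_VS]
  simp only [pr2, Pi.add_apply, Finset.sum_add_distrib, Finset.sum_pi_single', Finset.mem_univ,
    if_true]
  decide

lemma single_eq_pr2 {n : ℕ} {i j k : Fin n} (hj : j ≠ i) (hk : k ≠ i) (hjk : j ≠ k) :
    (Pi.single i 1 : Fin n → ZMod 2) = pr2 i k * pr2 i j := by
  funext l
  simp only [pr2, Pi.mul_apply, Pi.add_apply, Pi.single_apply]
  split_ifs <;> simp_all

lemma mul_pr2 {n : ℕ} {i k : Fin n} (x : Fin n → ZMod 2) (h : x k = x i) :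
    x * pr2 i k = x i • pr2 i k := by
  funext l
  simp only [pr2, Pi.mul_apply, Pi.add_apply, Pi.single_apply, Pi.smul_apply, smul_eq_mul]
  split_ifs <;> simp_all

lemma zmod2_eq_add_one {a b : ZMod 2} (h : a ≠ b) : a = b + 1 := by
  revert a b; decide

lemma exists_same {r : ℕ} (i : Fin (2*r)) (x : Fin (2*r) → ZMod 2) (hx : x ∈ VS (2*r)) :
    ∃ k, k ≠ i ∧ x k = x i := by
  by_contra! hcon
  have h : x = fun k => (x i + 1) + (Pi.single i 1 : Fin (2*r) → ZMod 2) k := by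
    funext k
    by_cases hk : k = i
    · subst hk
      rw [Pi.single_eq_same, add_assoc]
      have : (1 : ZMod 2) + 1 = 0 := by decide
      rw [this, add_zero]
    · rw [Pi.single_eq_of_ne hk, add_zero]
      exact zmod2_eq_add_one (hcon k hk)
  have h2 : (2 : ZMod 2) = 0 := by decide
  rw [mem_VS, h, Finset.sum_add_distrib, Finset.sum_pi_single'] at hx
  simp [h2] at hx

lemma one_mem_VS (r : ℕ) : (1 : Fin (2*r) → ZMod 2) ∈ VS (2*r) := by
  have h2 : (2 : ZMod 2) = 0 := by decide
  rw [mem_VS]; simp [h2]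

lemma IsW.map_one {r : ℕ} {σ : (Fin (2*r) → ZMod 2) ≃ₗ[ZMod 2] (Fin (2*r) → ZMod 2)}
    (h : IsW σ) : σ 1 = 1 := by
  have h1 : (1 : Fin (2*r) → ZMod 2) ∈ Submodule.map
      (σ : (Fin (2*r) → ZMod 2) →ₗ[ZMod 2] (Fin (2*r) → ZMod 2)) (VS (2*r)) := by
    rw [h.1]; exact one_mem_VS r
  obtain ⟨z, hz, hz1⟩ := h1
  have hz1 : σ z = 1 := hz1
  have := h.2 1 (one_mem_VS r) z hz
  rw [one_mul, hz1, mul_one] at this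
  exact this.symm

lemma IsW.map_mul_single {r : ℕ} {σ : (Fin (2*r) → ZMod 2) ≃ₗ[ZMod 2] (Fin (2*r) → ZMod 2)}
    (h : IsW σ) (i : Fin (2*r)) (x : Fin (2*r) → ZMod 2) (hx : x ∈ VS (2*r)) :
    σ (x * Pi.single i 1) = σ x * σ (Pi.single i 1) := by
  obtain ⟨k, hk, hxk⟩ := exists_same i x hx
  by_cases hj : ∃ j, j ≠ i ∧ j ≠ k
  · obtain ⟨j, hji, hjk⟩ := hj
    rw [single_eq_pr2 hji hk hjk, ← mul_assoc, h.2 _ (pr2_mem i k) _ (pr2_mem i j), ← mul_assoc,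
      ← h.2 x hx _ (pr2_mem i k), h.2 _ _ _ (pr2_mem i j)]
    rw [mul_pr2 x hxk]
    exact (VS _).smul_mem _ (pr2_mem i k)
  · push Not at hj
    have hx1 : x = x i • (1 : Fin (2*r) → ZMod 2) := by
      funext l
      by_cases hl : l = i
      · simp [hl]
      · simp [hj l hl, hxk]
    rw [hx1, smul_mul_assoc, one_mul, map_smul, map_smul, h.map_one, smul_mul_assoc, one_mul]

lemma exists_decomp {r : ℕ} (i : Fin (2*r)) (a : Fin (2*r) → ZMod 2) :
    ∃ x ∈ VS (2*r), ∃ c : ZMod 2, a = x + c • Pi.single i 1 := by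
  refine ⟨a - (∑ j, a j) • Pi.single i 1, ?_, ∑ j, a j, by simp⟩
  rw [mem_VS]
  simp only [Pi.sub_apply, Pi.smul_apply, smul_eq_mul, Finset.sum_sub_distrib, ← Finset.mul_sum,
    Finset.sum_pi_single', Finset.mem_univ, if_true]
  simp

lemma mul_self_f2 {n : ℕ} (a : Fin n → ZMod 2) : a * a = a := by
  funext l
  have : ∀ b : ZMod 2, b * b = b := by decide
  exact this _

lemma IsW.map_mul {r : ℕ} (hr : 0 < r)
    {σ : (Fin (2*r) → ZMod 2) ≃ₗ[ZMod 2] (Fin (2*r) → ZMod 2)}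
    (h : IsW σ) (a b : Fin (2*r) → ZMod 2) : σ (a * b) = σ a * σ b := by
  obtain ⟨x, hx, c, rfl⟩ := exists_decomp (⟨0, by omega⟩ : Fin (2*r)) a
  obtain ⟨y, hy, d, rfl⟩ := exists_decomp (⟨0, by omega⟩ : Fin (2*r)) b
  generalize hi : (⟨0, by omega⟩ : Fin (2*r)) = i
  have e1 := h.2 x hx y hy
  have e2 := h.map_mul_single i x hx
  have e3 := h.map_mul_single i y hy
  have e4 : σ (Pi.single i 1 * Pi.single i 1) = σ (Pi.single i 1) * σ (Pi.single i 1) := by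
    rw [mul_self_f2, mul_self_f2]
  rw [mul_comm y, mul_comm (σ y)] at e3
  simp only [add_mul, mul_add, map_add, smul_mul_assoc, mul_smul_comm, map_smul, e1, e2, e3, e4]

/-- there is a grading-preserving ring isomorphism R₁ ≅ R₂ iff some
σ ∈ 𝒲_{2r} maps Vᵢ¹ isomorphically onto Vᵢ² for all i < n−1. -/
theorem stmt10 (r n : ℕ) (hr : 0 < r) (hn : 2 ≤ n)
    (V₁ V₂ : ℕ → Submodule (ZMod 2) (Fin (2*r) → ZMod 2))
    (hchain₁ : ∀ i, i + 1 ≤ n - 1 → V₁ i ≤ V₁ (i+1))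
    (hchain₂ : ∀ i, i + 1 ≤ n - 1 → V₂ i ≤ V₂ (i+1))
    (h0₁ : V₁ 0 = Submodule.span (ZMod 2) {(1 : Fin (2*r) → ZMod 2)})
    (h0₂ : V₂ 0 = Submodule.span (ZMod 2) {(1 : Fin (2*r) → ZMod 2)})
    (htop₁ : V₁ (n-1) = VS (2*r)) (htop₂ : V₂ (n-1) = VS (2*r))
    (hmul₁ : ∀ i j u w, i + j ≤ n - 1 → u ∈ V₁ i → w ∈ V₁ j → u * w ∈ V₁ (i+j))
    (hmul₂ : ∀ i j u w, i + j ≤ n - 1 → u ∈ V₂ i → w ∈ V₂ j → u * w ∈ V₂ (i+j))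
    (S₁ S₂ : Subring (Polynomial (Fin (2*r) → ZMod 2)))
    (hS₁ : (S₁ : Set (Polynomial (Fin (2*r) → ZMod 2))) =
      {p : Polynomial (Fin (2*r) → ZMod 2) | ∀ i ≤ n - 1, p.coeff i ∈ V₁ i})
    (hS₂ : (S₂ : Set (Polynomial (Fin (2*r) → ZMod 2))) =
      {p : Polynomial (Fin (2*r) → ZMod 2) | ∀ i ≤ n - 1, p.coeff i ∈ V₂ i}) :
    (∃ f : S₁ ≃+* S₂, ∀ (i : ℕ) (p : S₁),
        IsHomog i (p : Polynomial (Fin (2*r) → ZMod 2)) ↔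
          IsHomog i ((f p : S₂) : Polynomial (Fin (2*r) → ZMod 2))) ↔
      (∃ σ : (Fin (2*r) → ZMod 2) ≃ₗ[ZMod 2] (Fin (2*r) → ZMod 2), IsW σ ∧
        ∀ i < n - 1,
          Submodule.map (σ : (Fin (2*r) → ZMod 2) →ₗ[ZMod 2] (Fin (2*r) → ZMod 2)) (V₁ i)
            = V₂ i) := by
  have mem₁ : ∀ p, p ∈ S₁ ↔ ∀ i ≤ n - 1, p.coeff i ∈ V₁ i := fun p => by
    rw [← SetLike.mem_coe, hS₁]; rfl
  have mem₂ : ∀ p, p ∈ S₂ ↔ ∀ i ≤ n - 1, p.coeff i ∈ V₂ i := fun p => by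
    rw [← SetLike.mem_coe, hS₂]; rfl
  have low₁ : ∀ i x, i ≤ n - 1 → x ∈ V₁ i → Polynomial.monomial i x ∈ S₁ := by
    intro i x _ hx
    rw [mem₁]
    intro j _
    rw [Polynomial.coeff_monomial]
    split_ifs with h
    · exact h ▸ hx
    · exact Submodule.zero_mem _
  have low₂ : ∀ i x, i ≤ n - 1 → x ∈ V₂ i → Polynomial.monomial i x ∈ S₂ := by
    intro i x _ hx
    rw [mem₂]
    intro j _
    rw [Polynomial.coeff_monomial]
    split_ifs with h
    · exact h ▸ hx
    · exact Submodule.zero_mem _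
  have high₁ : ∀ i x, n ≤ i → Polynomial.monomial i x ∈ S₁ := by
    intro i x hi
    rw [mem₁]
    intro j hj
    rw [Polynomial.coeff_monomial, if_neg (by omega)]
    exact Submodule.zero_mem _
  have high₂ : ∀ i x, n ≤ i → Polynomial.monomial i x ∈ S₂ := by
    intro i x hi
    rw [mem₂]
    intro j hj
    rw [Polynomial.coeff_monomial, if_neg (by omega)]
    exact Submodule.zero_mem _
  constructor
  · rintro ⟨f, hf⟩
    have key : ∀ i (p : S₁), IsHomog i (p : Polynomial (Fin (2*r) → ZMod 2)) →
        ((f p : S₂) : Polynomial (Fin (2*r) → ZMod 2)) =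
          Polynomial.monomial i (((f p : S₂) : Polynomial (Fin (2*r) → ZMod 2)).coeff i) :=
      fun i p hp => ((hf i p).1 hp).eq_monomial
    let M : (Fin (2*r) → ZMod 2) → S₁ := fun x => ⟨Polynomial.monomial n x, high₁ n x le_rfl⟩
    let g : (Fin (2*r) → ZMod 2) →+ (Fin (2*r) → ZMod 2) :=
      { toFun := fun x => ((f (M x) : S₂) : Polynomial (Fin (2*r) → ZMod 2)).coeff n
        map_zero' := by
          have : M 0 = 0 := Subtype.ext (by simp [M])
          rw [this]; simp
        map_add' := by
          intro x y
          have : M (x + y) = M x + M y := Subtype.ext (by simp [M])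
          rw [this]; simp }
    have hg : ∀ x, ((f (M x) : S₂) : Polynomial (Fin (2*r) → ZMod 2)) =
        Polynomial.monomial n (g x) := fun x => key n (M x) (isHomog_monomial n x)
    have ginj : Function.Injective g := by
      intro x y hxy
      have h1 : f (M x) = f (M y) := Subtype.ext (by rw [hg, hg, hxy])
      have h2 := congrArg Subtype.val (f.injective h1)
      exact Polynomial.monomial_injective n h2
    have one₁ : (1 : Fin (2*r) → ZMod 2) ∈ V₁ 1 :=
      hchain₁ 0 (by omega) (by rw [h0₁]; exact Submodule.mem_span_singleton_self _)
    let T : S₁ := ⟨Polynomial.monomial 1 1, low₁ 1 1 (by omega) one₁⟩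
    have hT : ((f T : S₂) : Polynomial (Fin (2*r) → ZMod 2)) = Polynomial.X := by
      have h1 := key 1 T (isHomog_monomial 1 1)
      set u := ((f T : S₂) : Polynomial (Fin (2*r) → ZMod 2)).coeff 1 with hu
      let Q : S₂ := ⟨Polynomial.monomial (n+1) 1, high₂ (n+1) 1 (by omega)⟩
      have h2 : IsHomog (n+1) ((f.symm Q : S₁) : Polynomial (Fin (2*r) → ZMod 2)) := by
        rw [hf, f.apply_symm_apply]; exact isHomog_monomial _ _
      have h3 := h2.eq_monomial
      set x := ((f.symm Q : S₁) : Polynomial (Fin (2*r) → ZMod 2)).coeff (n+1)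
      have h4 : f.symm Q = T * M x := Subtype.ext (by
        rw [h3]; simp [T, M, Polynomial.monomial_mul_monomial, add_comm])
      have h5 : Q = f T * f (M x) := by rw [← map_mul, ← h4, f.apply_symm_apply]
      have h6 := congrArg Subtype.val h5
      rw [Subring.coe_mul, h1, hg, Polynomial.monomial_mul_monomial, add_comm 1 n] at h6
      have h7 : 1 = u * g x := Polynomial.monomial_injective (n+1) h6
      have h8 : u = 1 := by
        have h9 : u * (u * g x) = u * g x := by rw [← mul_assoc, mul_self_f2]
        rw [← h7, mul_one] at h9
        exact h9
      rw [h1, h8, Polynomial.monomial_one_one_eq_X]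
    have hTk : ∀ k (p : S₁), ((f (T ^ k * p) : S₂) : Polynomial (Fin (2*r) → ZMod 2)) =
        Polynomial.X ^ k * ((f p : S₂) : Polynomial (Fin (2*r) → ZMod 2)) := by
      intro k p
      rw [map_mul, map_pow, Subring.coe_mul, Subring.coe_pow, hT]
    have hTc : ∀ k, ((T ^ k : S₁) : Polynomial (Fin (2*r) → ZMod 2)) = Polynomial.X ^ k := by
      intro k
      rw [Subring.coe_pow]
      simp only [T, Polynomial.monomial_one_one_eq_X]
    have gmul : ∀ x y, g (x * y) = g x * g y := by
      intro x y
      have h1 : M x * M y = T ^ n * M (x * y) := Subtype.ext (by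
        rw [Subring.coe_mul, Subring.coe_mul, hTc]
        simp [M, Polynomial.monomial_mul_monomial, Polynomial.X_pow_mul_monomial])
      have h2 := hTk n (M (x * y))
      rw [← h1, map_mul, Subring.coe_mul, hg, hg, hg, Polynomial.monomial_mul_monomial,
        Polynomial.X_pow_mul_monomial] at h2
      exact (Polynomial.monomial_injective _ h2).symm
    -- restriction
    have hlow : ∀ i ≤ n - 1, ∀ (p : S₁) x y,
        (p : Polynomial (Fin (2*r) → ZMod 2)) = Polynomial.monomial i x →
        ((f p : S₂) : Polynomial (Fin (2*r) → ZMod 2)) = Polynomial.monomial i y → g x = y := by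
      intro i hi p x y hp hfp
      have h1 : M x = T ^ (n - i) * p := Subtype.ext (by
        rw [Subring.coe_mul, hTc, hp, Polynomial.X_pow_mul_monomial]
        rw [show i + (n - i) = n by omega])
      have h2 := hTk (n - i) p
      rw [← h1, hg, hfp, Polynomial.X_pow_mul_monomial, show i + (n - i) = n by omega] at h2
      exact Polynomial.monomial_injective _ h2
    let σ : (Fin (2*r) → ZMod 2) ≃ₗ[ZMod 2] (Fin (2*r) → ZMod 2) :=
      LinearEquiv.ofInjectiveEndo (g.toZModLinearMap 2) ginj
    have hσ : ∀ x, σ x = g x := fun x => rfl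
    have hmap : ∀ i ≤ n - 1,
        Submodule.map (σ : (Fin (2*r) → ZMod 2) →ₗ[ZMod 2] (Fin (2*r) → ZMod 2)) (V₁ i)
          = V₂ i := by
      intro i hi
      apply le_antisymm
      · rintro _ ⟨x, hx, rfl⟩
        let p : S₁ := ⟨Polynomial.monomial i x, low₁ i x hi hx⟩
        have h1 := key i p (isHomog_monomial i x)
        have h2 := hlow i hi p x _ rfl h1
        have h3 := (mem₂ _).1 (f p).2 i hi
        rw [← h2] at h3
        exact h3
      · intro y hy
        let q : S₂ := ⟨Polynomial.monomial i y, low₂ i y hi hy⟩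
        have h1 : IsHomog i ((f.symm q : S₁) : Polynomial (Fin (2*r) → ZMod 2)) := by
          rw [hf, f.apply_symm_apply]; exact isHomog_monomial _ _
        have h2 := hlow i hi (f.symm q) _ y h1.eq_monomial (by rw [f.apply_symm_apply])
        exact ⟨_, (mem₁ _).1 (f.symm q).2 i hi, h2⟩
    refine ⟨σ, ⟨?_, fun x _ y _ => gmul x y⟩, fun i hi => hmap i hi.le⟩
    have := hmap (n-1) le_rfl
    rwa [htop₁, htop₂] at this
  · rintro ⟨σ, hW, hσ⟩
    let τ : (Fin (2*r) → ZMod 2) ≃+* (Fin (2*r) → ZMod 2) :=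
      { σ.toAddEquiv with map_mul' := hW.map_mul hr }
    have hτ : ∀ x, τ x = σ x := fun x => rfl
    have hV : ∀ i ≤ n - 1, ∀ x, τ x ∈ V₂ i ↔ x ∈ V₁ i := by
      intro i hi x
      have h1 : Submodule.map
          (σ : (Fin (2*r) → ZMod 2) →ₗ[ZMod 2] (Fin (2*r) → ZMod 2)) (V₁ i) = V₂ i := by
        rcases hi.lt_or_eq with h | h
        · exact hσ i h
        · rw [h, htop₁, htop₂]; exact hW.1
      rw [← h1]
      constructor
      · rintro ⟨y, hy, hyx⟩
        have : y = x := σ.injective hyx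
        exact this ▸ hy
      · intro hx
        exact ⟨x, hx, rfl⟩
    let F := Polynomial.mapEquiv τ
    have hF : ∀ p i, (F p).coeff i = τ (p.coeff i) := by
      intro p i
      simp [F]
    have hFS : ∀ p, F p ∈ S₂ ↔ p ∈ S₁ := by
      intro p
      rw [mem₁, mem₂]
      simp only [hF]
      exact forall₂_congr fun i hi => hV i hi _
    let f : S₁ ≃+* S₂ :=
      { toFun := fun p => ⟨F p, (hFS p).2 p.2⟩
        invFun := fun q => ⟨F.symm q, (hFS _).1 (by rw [F.apply_symm_apply]; exact q.2)⟩
        left_inv := fun p => Subtype.ext (F.symm_apply_apply _)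
        right_inv := fun p => Subtype.ext (F.apply_symm_apply _)
        map_mul' := fun p q => Subtype.ext (map_mul F _ _)
        map_add' := fun p q => Subtype.ext (map_add F _ _) }
    refine ⟨f, fun i p => ?_⟩
    refine forall₂_congr fun j _ => ?_
    change _ ↔ (F p).coeff j = 0
    rw [hF, map_eq_zero_iff τ τ.injective]
end

section
/- Let r be a positive integer and A ∈ ℳ_r. Then there exist a 2r×2r permutation matrix σ and λ ∈ GL(r,𝔽₂) such that σAλ is the block matrix with I_r (the r×r identity) on top and some matrix P below, where moreover P ∈ O(r,𝔽₂), i.e. PᵀP = I_r. -/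
/-- ℳ_r: 2r×r matrices over 𝔽₂ of rank r whose columns vᵢ satisfy vᵢ∘vⱼ ∈ 𝒱_{2r}. -/
def MemM (r : ℕ) (A : Matrix (Fin (2*r)) (Fin r) (ZMod 2)) : Prop :=
  A.rank = r ∧ ∀ j k : Fin r, (fun i => A i j * A i k) ∈ VS (2*r)

/-- The permutation matrix of σ. -/
def permMat {n : ℕ} (σ : Equiv.Perm (Fin n)) : Matrix (Fin n) (Fin n) (ZMod 2) :=
  Matrix.of fun i j => if σ j = i then 1 else 0

/-- The 2r×r matrix with P stacked on top of Q. -/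
def stack {r : ℕ} (P Q : Matrix (Fin r) (Fin r) (ZMod 2)) :
    Matrix (Fin (2*r)) (Fin r) (ZMod 2) :=
  Matrix.of fun i j =>
    if h : (i : ℕ) < r then P ⟨i, h⟩ j
    else Q ⟨(i : ℕ) - r, by have := i.isLt; omega⟩ j

/-- A ∼ B iff B = σAλ for a permutation matrix σ and λ ∈ GL(r,𝔽₂). -/
def EquivMat (r : ℕ) (A B : Matrix (Fin (2*r)) (Fin r) (ZMod 2)) : Prop :=
  ∃ (σ : Equiv.Perm (Fin (2*r))) (lam : Matrix (Fin r) (Fin r) (ZMod 2)),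
    IsUnit lam ∧ permMat σ * A * lam = B

lemma sum_two_mul_aux {r : ℕ} (f : Fin (2*r) → ZMod 2) :
    ∑ i, f i = (∑ i : Fin r, f ⟨i, by omega⟩) + ∑ i : Fin r, f ⟨r + i, by omega⟩ := by
  rw [← Equiv.sum_comp (finSumFinEquiv.trans (finCongr (two_mul r).symm)) f,
    Fintype.sum_sum_type]
  congr 1

lemma exists_perm_aux {r : ℕ} (f : Fin r → Fin (2*r)) (hf : Function.Injective f) :
    ∃ e : Equiv.Perm (Fin (2*r)), ∀ i : Fin r, e ⟨i, by omega⟩ = f i := by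
  classical
  let g : Fin (2*r) → Fin (2*r) := fun i => if h : (i : ℕ) < r then f ⟨i, h⟩ else i
  obtain ⟨e, he⟩ := Finset.exists_equiv_extend_of_card_eq (α := Fin (2*r)) (β := Fin (2*r))
    (t := Finset.univ) (by simp) (s := Finset.univ.filter fun i => (i : ℕ) < r) (f := g)
    (Finset.subset_univ _) (by
      intro a ha b hb hab
      simp only [Finset.coe_filter, Finset.mem_univ, true_and, Set.mem_setOf_eq] at ha hb
      simp only [g, ha, hb, dif_pos] at hab
      have := hf hab
      simp only [Fin.mk.injEq] at this
      exact Fin.ext this)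
  refine ⟨e.trans (Equiv.subtypeUnivEquiv (by simp)), fun i => ?_⟩
  have := he ⟨i, by omega⟩ (by simp)
  simpa [g] using this

lemma permMat_mul_aux {n m : ℕ} (e : Equiv.Perm (Fin n)) (A : Matrix (Fin n) (Fin m) (ZMod 2)) :
    permMat e.symm * A = A.submatrix e id := by
  ext i j
  simp [permMat, Matrix.mul_apply, Equiv.symm_apply_eq]

lemma exists_rows_aux {r n : ℕ} (A : Matrix (Fin n) (Fin r) (ZMod 2)) (h : A.rank = r) :
    ∃ f : Fin r → Fin n, Function.Injective f ∧ IsUnit (A.submatrix f id) := by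
  obtain ⟨κ, a, ha, hsp, hli⟩ := exists_linearIndependent' (ZMod 2) A.row
  have : Finite κ := Finite.of_injective a ha
  have : Fintype κ := Fintype.ofFinite κ
  have hc : Fintype.card κ = r := by
    rw [← finrank_span_eq_card hli, hsp, ← Matrix.rank_eq_finrank_span_row, h]
  let e := (Fintype.equivFinOfCardEq hc).symm
  refine ⟨a ∘ e, ha.comp e.injective, ?_⟩
  rw [← Matrix.linearIndependent_rows_iff_isUnit]
  exact hli.comp e e.injective

/-- every A ∈ ℳ_r is equivalent, via a row permutation σ and
λ ∈ GL(r,𝔽₂), to a matrix with I_r on top and P below, where P ∈ O(r,𝔽₂). -/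
theorem stmt11 (r : ℕ) (hr : 0 < r) (A : Matrix (Fin (2*r)) (Fin r) (ZMod 2))
    (hA : MemM r A) :
    ∃ (σ : Equiv.Perm (Fin (2*r))) (lam P : Matrix (Fin r) (Fin r) (ZMod 2)),
      IsUnit lam ∧ P.transpose * P = 1 ∧
        permMat σ * A * lam = stack (1 : Matrix (Fin r) (Fin r) (ZMod 2)) P := by
  obtain ⟨hrank, hV⟩ := hA
  obtain ⟨f, hf, hu⟩ := exists_rows_aux A hrank
  obtain ⟨e, he⟩ := exists_perm_aux f hf
  have hdet := (Matrix.isUnit_iff_isUnit_det _).1 hu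
  set B := A.submatrix f id with hB
  let Q : Matrix (Fin r) (Fin r) (ZMod 2) :=
    A.submatrix (fun i : Fin r => e ⟨r + i, by omega⟩) id
  have hBQ : B.transpose * B + Q.transpose * Q = 0 := by
    ext j k
    have h1 := (mem_VS _).1 (hV j k)
    rw [← Equiv.sum_comp e, sum_two_mul_aux] at h1
    simp only [he] at h1
    simpa [Matrix.mul_apply, hB, Q] using h1
  have hQB : Q.transpose * Q = B.transpose * B := by
    have h2 : B.transpose * B + B.transpose * B = 0 := by
      ext j k
      exact CharTwo.add_self_eq_zero _
    exact add_left_cancel (hBQ.trans h2.symm)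
  refine ⟨e.symm, B⁻¹, Q * B⁻¹, ?_, ?_, ?_⟩
  · exact (Matrix.isUnit_nonsing_inv_iff).2 hu
  · rw [Matrix.transpose_mul, Matrix.mul_assoc, ← Matrix.mul_assoc Q.transpose, hQB,
      Matrix.mul_assoc, Matrix.mul_nonsing_inv _ hdet, Matrix.mul_one,
      ← Matrix.transpose_mul, Matrix.mul_nonsing_inv _ hdet, Matrix.transpose_one]
  · rw [permMat_mul_aux]
    ext i j
    by_cases h : (i : ℕ) < r
    · have h3 : e i = f ⟨i, h⟩ := he ⟨i, h⟩
      rw [← Matrix.mul_nonsing_inv _ hdet]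
      simp [stack, h, Matrix.mul_apply, hB, h3]
    · have h4 : (⟨r + ((i : ℕ) - r), by omega⟩ : Fin (2*r)) = i := Fin.ext (by simp; omega)
      simp [stack, h, Matrix.mul_apply, Q, h4]
end

section
/- Let r be a positive integer. Define an equivalence relation on ℳ_r by A ∼ B iff there exist a 2r×2r permutation matrix σ and λ ∈ GL(r,𝔽₂) with σAλ = B, and an equivalence relation on O(r,𝔽₂) by P ≈ Q iff there exist r×r permutation matrices τ, ρ with τPρ = Q. Then the number of equivalence classes of ℳ_r under ∼ is at most the number of equivalence classes of O(r,𝔽₂) under ≈; i.e. |S_{2r}\ℳ_r/GL(r,𝔽₂)| ≤ |S_r\O(r,𝔽₂)/S_r|. -/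
/-- The relation on ℳ_r: A ∼ B iff B = σAλ with σ a row permutation, λ ∈ GL(r,𝔽₂). -/
def relM (r : ℕ) (A B : {A : Matrix (Fin (2*r)) (Fin r) (ZMod 2) // MemM r A}) : Prop :=
  EquivMat r A.1 B.1

/-- The relation on O(r,𝔽₂): P ≈ Q iff Q = τPρ with τ, ρ permutation matrices. -/
def relO (r : ℕ) (P Q : {P : Matrix (Fin r) (Fin r) (ZMod 2) // P.transpose * P = 1}) :
    Prop :=
  ∃ τ ρ : Equiv.Perm (Fin r), permMat τ * P.1 * permMat ρ = Q.1

lemma permMat_mul_apply {n m : ℕ} (σ : Equiv.Perm (Fin n)) (A : Matrix (Fin n) (Fin m) (ZMod 2))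
    (i : Fin n) (j : Fin m) : (permMat σ * A) i j = A (σ.symm i) j := by
  rw [Matrix.mul_apply, Finset.sum_eq_single (σ.symm i)]
  · simp [permMat]
  · intro b _ hb
    have : σ b ≠ i := by
      rintro rfl
      simp at hb
    simp [permMat, this]
  · simp

lemma mul_permMat_apply {n m : ℕ} (σ : Equiv.Perm (Fin n)) (A : Matrix (Fin m) (Fin n) (ZMod 2))
    (i : Fin m) (j : Fin n) : (A * permMat σ) i j = A i (σ j) := by
  rw [Matrix.mul_apply, Finset.sum_eq_single (σ j)]
  · simp [permMat]
  · intro b _ hb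
    simp [permMat, hb.symm]
  · simp

lemma isUnit_permMat {n : ℕ} (σ : Equiv.Perm (Fin n)) : IsUnit (permMat σ) := by
  have h : ∀ τ : Equiv.Perm (Fin n), permMat τ * permMat τ.symm = 1 := by
    intro τ
    ext i j
    rw [permMat_mul_apply]
    by_cases h : i = j
    · subst h
      simp [permMat]
    · simp [permMat, h, Ne.symm h]
  exact ⟨⟨permMat σ, permMat σ.symm, h σ, by simpa using h σ.symm⟩, rfl⟩

/-- The splitting of the `2r` rows in two halves. -/
def eSplit (r : ℕ) : Fin r ⊕ Fin r ≃ Fin (2 * r) :=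
  finSumFinEquiv.trans (finCongr (two_mul r).symm)

lemma stack_inl {r : ℕ} (P Q : Matrix (Fin r) (Fin r) (ZMod 2)) (i j : Fin r) :
    stack P Q (eSplit r (Sum.inl i)) j = P i j := by
  simp [stack, eSplit]

lemma stack_inr {r : ℕ} (P Q : Matrix (Fin r) (Fin r) (ZMod 2)) (i j : Fin r) :
    stack P Q (eSplit r (Sum.inr i)) j = Q i j := by
  simp [stack, eSplit]

lemma equivMat_of {r : ℕ} (A B : Matrix (Fin (2*r)) (Fin r) (ZMod 2))
    (σ : Equiv.Perm (Fin (2*r))) (lam : Matrix (Fin r) (Fin r) (ZMod 2)) (hl : IsUnit lam)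
    (h : ∀ x j, (A * lam) (σ (eSplit r x)) j = B (eSplit r x) j) : EquivMat r A B := by
  refine ⟨σ.symm, lam, hl, ?_⟩
  ext i j
  rw [Matrix.mul_assoc, permMat_mul_apply]
  obtain ⟨x, rfl⟩ := (eSplit r).surjective i
  simpa using h x j

lemma memM_stack {r : ℕ} (P : Matrix (Fin r) (Fin r) (ZMod 2)) (h : P.transpose * P = 1) :
    MemM r (stack 1 P) := by
  constructor
  · apply le_antisymm
    · simpa using Matrix.rank_le_card_width (stack 1 P)
    · have h1 : (stack 1 P).submatrix (fun i => eSplit r (Sum.inl i)) id = 1 := by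
        ext i j
        simp [stack_inl]
      have h2 := Matrix.rank_submatrix_le (stack 1 P) (fun i => eSplit r (Sum.inl i)) id
      rw [h1, Matrix.rank_one, Fintype.card_fin] at h2
      exact h2
  · intro j k
    rw [mem_VS, ← (eSplit r).sum_comp, Fintype.sum_sum_type]
    simp only [stack_inl, stack_inr]
    have h2 := congrFun (congrFun h j) k
    simp only [Matrix.mul_apply, Matrix.transpose_apply] at h2
    rw [h2]
    have : ∑ x, (1 : Matrix (Fin r) (Fin r) (ZMod 2)) x j * (1 : Matrix (Fin r) (Fin r) (ZMod 2)) x k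
        = (1 : Matrix (Fin r) (Fin r) (ZMod 2)) j k := by
      simp [Matrix.one_apply, eq_comm]
    rw [this]
    exact CharTwo.add_self_eq_zero _

lemma exists_rows {r : ℕ} (A : Matrix (Fin (2*r)) (Fin r) (ZMod 2)) (h : A.rank = r) :
    ∃ f : Fin r → Fin (2*r), Function.Injective f ∧ IsUnit (A.submatrix f id) := by
  obtain ⟨κ, a, ha, hs, hi⟩ := exists_linearIndependent' (ZMod 2) A.row
  have : Finite κ := Finite.of_injective a ha
  have : Fintype κ := Fintype.ofFinite κ
  have hc : Fintype.card κ = r := by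
    have := finrank_span_eq_card hi
    rw [hs, ← Matrix.rank_eq_finrank_span_row, h] at this
    exact this.symm
  let e : Fin r ≃ κ := (Fintype.equivFinOfCardEq hc).symm
  refine ⟨a ∘ e, ha.comp e.injective, ?_⟩
  rw [← Matrix.linearIndependent_rows_iff_isUnit]
  exact hi.comp e e.injective

lemma exists_stack {r : ℕ} (A : Matrix (Fin (2*r)) (Fin r) (ZMod 2)) (h : MemM r A) :
    ∃ Q : Matrix (Fin r) (Fin r) (ZMod 2), Q.transpose * Q = 1 ∧ EquivMat r A (stack 1 Q) := by
  obtain ⟨f, hf, hX⟩ := exists_rows A h.1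
  obtain ⟨σ, hσ⟩ : ∃ σ : Equiv.Perm (Fin (2*r)), ∀ i, σ (eSplit r (Sum.inl i)) = f i := by
    let p : Fin r ↪ Fin (2*r) := ⟨fun i => eSplit r (Sum.inl i), fun a b h => by simpa using h⟩
    let e : Set.range p ≃ Set.range f :=
      (Equiv.ofInjective p p.injective).symm.trans (Equiv.ofInjective f hf)
    classical
    refine ⟨Equiv.extendSubtype (p := (· ∈ Set.range p)) (q := (· ∈ Set.range f)) e, fun i => ?_⟩
    have h1 : eSplit r (Sum.inl i) ∈ Set.range p := ⟨i, rfl⟩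
    rw [Equiv.extendSubtype_apply_of_mem (p := (· ∈ Set.range p)) (q := (· ∈ Set.range f)) e _ h1]
    have : (⟨eSplit r (Sum.inl i), h1⟩ : Set.range p) = Equiv.ofInjective p p.injective i := rfl
    simp only [e, Equiv.trans_apply]
    erw [this]
    simp
  set X := A.submatrix f id with hXd
  set Y : Matrix (Fin r) (Fin r) (ZMod 2) :=
    A.submatrix (fun i => σ (eSplit r (Sum.inr i))) id with hYd
  have hdet : IsUnit X.det := (Matrix.isUnit_iff_isUnit_det X).1 hX
  have hXY : X.transpose * X + Y.transpose * Y = 0 := by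
    ext j k
    have := h.2 j k
    rw [mem_VS, ← ((eSplit r).trans σ).sum_comp, Fintype.sum_sum_type] at this
    simpa [Matrix.mul_apply, hXd, hYd, hσ] using this
  refine ⟨Y * X⁻¹, ?_, equivMat_of _ _ σ X⁻¹ ?_ ?_⟩
  · have h1 : Y.transpose * Y = X.transpose * X := by
      rw [← sub_eq_zero, ← hXY]
      ext j k
      simp only [Matrix.sub_apply, Matrix.add_apply, CharTwo.sub_eq_add]
      rw [add_comm]
    calc (Y * X⁻¹).transpose * (Y * X⁻¹) = X⁻¹.transpose * (Y.transpose * Y) * X⁻¹ := by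
          simp only [Matrix.transpose_mul, Matrix.mul_assoc]
      _ = (X * X⁻¹).transpose * (X * X⁻¹) := by
          rw [h1]; simp only [Matrix.transpose_mul, Matrix.mul_assoc]
      _ = 1 := by rw [Matrix.mul_nonsing_inv _ hdet]; simp
  · exact (Matrix.isUnit_nonsing_inv_iff).2 hX
  · rintro (i | i) j
    · rw [stack_inl, hσ, ← Matrix.mul_nonsing_inv _ hdet]
      rfl
    · rw [stack_inr]
      rfl

lemma relO_stack {r : ℕ} (P Q : Matrix (Fin r) (Fin r) (ZMod 2)) (τ ρ : Equiv.Perm (Fin r))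
    (h : permMat τ * P * permMat ρ = Q) : EquivMat r (stack 1 P) (stack 1 Q) := by
  refine equivMat_of _ _ ((eSplit r).symm.trans ((Equiv.sumCongr ρ τ.symm).trans (eSplit r)))
    (permMat ρ) (isUnit_permMat ρ) ?_
  rintro (i | i) j
  · simp [mul_permMat_apply, stack_inl, Matrix.one_apply]
  · simp [mul_permMat_apply, permMat_mul_apply, stack_inr, ← h]

/-- |S_{2r}\ℳ_r/GL(r,𝔽₂)| ≤ |S_r\O(r,𝔽₂)/S_r|. -/
theorem stmt12 (r : ℕ) (hr : 0 < r) :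
    Nat.card (Quot (relM r)) ≤ Nat.card (Quot (relO r)) := by
  have : Finite (Quot (relO r)) := Quot.finite _
  let F : Quot (relO r) → Quot (relM r) :=
    Quot.lift (fun P => Quot.mk (relM r) ⟨stack 1 P.1, memM_stack P.1 P.2⟩) (by
      rintro P Q ⟨τ, ρ, h⟩
      exact Quot.sound (relO_stack P.1 Q.1 τ ρ h))
  refine Nat.card_le_card_of_surjective F ?_
  rintro ⟨A, hA⟩
  obtain ⟨Q, hQ, h⟩ := exists_stack A hA
  refine ⟨Quot.mk _ ⟨Q, hQ⟩, ?_⟩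
  symm
  exact Quot.sound h
end

section
/- Let r be a positive integer and A ∈ ℳ_r. If A is not irreducible, then there exist positive integers k, l with k + l = r and matrices B ∈ ℳ_k, C ∈ ℳ_l such that A is equivalent to the block-diagonal matrix diag(B, C) (a 2r×r matrix with B in the upper-left 2k×k block, C in the lower-right 2l×l block, and zeros elsewhere), where A ∼ A' means there exist a 2r×2r permutation matrix σ and λ ∈ GL(r,𝔽₂) with σAλ = A'. -/
/-- The span of the columns of A. -/
def colSpan {N r : ℕ} (A : Matrix (Fin N) (Fin r) (ZMod 2)) :
    Submodule (ZMod 2) (Fin N → ZMod 2) :=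
  Submodule.span (ZMod 2) (Set.range fun j i => A i j)

/-- A ∈ ℳ_r is irreducible if the span of its columns admits no direct-sum
decomposition into more than one nonzero subspace with pairwise zero
coordinatewise products. -/
def IrredMat {N r : ℕ} (A : Matrix (Fin N) (Fin r) (ZMod 2)) : Prop :=
  ¬ ∃ (l : ℕ) (W : Fin l → Submodule (ZMod 2) (Fin N → ZMod 2)),
      1 < l ∧ (∀ i, W i ≠ ⊥) ∧
      (∀ i j, i ≠ j → ∀ x ∈ W i, ∀ y ∈ W j, x * y = 0) ∧
      (⨆ i, W i) = colSpan A ∧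
      (∀ i : Fin l, Disjoint (W i) (⨆ j ∈ ({i}ᶜ : Set (Fin l)), W j))

/-- The block-diagonal 2(k+l)×(k+l) matrix diag(B, C). -/
def blockDiag2 {k l : ℕ} (B : Matrix (Fin (2*k)) (Fin k) (ZMod 2))
    (C : Matrix (Fin (2*l)) (Fin l) (ZMod 2)) :
    Matrix (Fin (2*(k+l))) (Fin (k+l)) (ZMod 2) :=
  Matrix.of fun i j =>
    if hi : (i : ℕ) < 2*k then
      if hj : (j : ℕ) < k then B ⟨i, hi⟩ ⟨j, hj⟩ else 0
    else
      if (j : ℕ) < k then 0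
      else C ⟨(i : ℕ) - 2*k, by have := i.isLt; omega⟩
             ⟨(j : ℕ) - k, by have := j.isLt; omega⟩


lemma rank_of_indep {m n : ℕ} (M : Matrix (Fin m) (Fin n) (ZMod 2))
    (h : LinearIndependent (ZMod 2) (fun j i => M i j)) : M.rank = n := by
  have h' : LinearIndependent (ZMod 2) M.transpose.row := h
  have := h'.rank_matrix
  rw [Matrix.rank_transpose] at this
  simpa using this

lemma two_mul_le {m k : ℕ} (M : Matrix (Fin m) (Fin k) (ZMod 2))
    (h : M.rank = k) (h2 : M.transpose * M = 0) : 2 * k ≤ m := by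
  have := Matrix.rank_add_rank_le_card_of_mul_eq_zero h2
  rw [Matrix.rank_transpose] at this
  simp at this
  omega

/-- restricting independent vectors to coordinates containing the support. -/
lemma indep_restrict {N m k : ℕ} (b : Fin k → Fin N → ZMod 2)
    (hb : LinearIndependent (ZMod 2) b) (f : Fin m → Fin N)
    (hf : ∀ i, i ∉ Set.range f → ∀ j, b j i = 0) :
    LinearIndependent (ZMod 2) (fun j i => b j (f i)) := by
  rw [Fintype.linearIndependent_iff] at hb ⊢
  intro g hg
  apply hb g
  funext i
  by_cases hi : i ∈ Set.range f
  · obtain ⟨a, rfl⟩ := hi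
    have := congrFun hg a
    simpa using this
  · simp [hf i hi]

lemma sum_restrict {N m : ℕ} (x : Fin N → ZMod 2) (f : Fin m → Fin N)
    (hinj : Function.Injective f) (hf : ∀ i, i ∉ Set.range f → x i = 0) :
    ∑ i, x (f i) = ∑ i, x i := by
  exact Fintype.sum_of_injective f hinj _ _ hf (fun _ => rfl)

lemma memM_aux {N m k : ℕ} (b : Fin k → Fin N → ZMod 2)
    (hb : LinearIndependent (ZMod 2) b) (f : Fin m → Fin N)
    (hinj : Function.Injective f)
    (horth : ∀ j j', ∑ i, b j i * b j' i = 0)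
    (hf : ∀ i, i ∉ Set.range f → ∀ j, b j i = 0) :
    (Matrix.of fun i j => b j (f i)).rank = k ∧
      ∀ j j', ∑ i, b j (f i) * b j' (f i) = 0 := by
  refine ⟨rank_of_indep _ (indep_restrict b hb f hf), fun j j' => ?_⟩
  rw [sum_restrict (fun i => b j i * b j' i) f hinj, horth]
  intro i hi
  simp [hf i hi]

lemma two_mul_le' {N m k : ℕ} (b : Fin k → Fin N → ZMod 2)
    (hb : LinearIndependent (ZMod 2) b) (f : Fin m → Fin N)
    (hinj : Function.Injective f)
    (horth : ∀ j j', ∑ i, b j i * b j' i = 0)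
    (hf : ∀ i, i ∉ Set.range f → ∀ j, b j i = 0) : 2 * k ≤ m := by
  obtain ⟨h1, h2⟩ := memM_aux b hb f hinj horth hf
  refine two_mul_le _ h1 ?_
  ext j j'
  simpa [Matrix.mul_apply] using h2 j j'

lemma permMat_mul {n r : ℕ} (σ : Equiv.Perm (Fin n)) (M : Matrix (Fin n) (Fin r) (ZMod 2))
    (i : Fin n) (j : Fin r) : (permMat σ * M) i j = M (σ.symm i) j := by
  simp only [permMat, Matrix.mul_apply, Matrix.of_apply, ite_mul, one_mul, zero_mul]
  rw [Finset.sum_eq_single (σ.symm i)]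
  · simp
  · intro b _ hb
    rw [if_neg]
    rintro rfl
    simp at hb
  · simp

lemma orth_of_colSpan {N r : ℕ} (A : Matrix (Fin N) (Fin r) (ZMod 2))
    (h : ∀ j k, ∑ i, A i j * A i k = 0) (x y : Fin N → ZMod 2)
    (hx : x ∈ colSpan A) (hy : y ∈ colSpan A) : ∑ i, x i * y i = 0 := by
  have h0 : A.transpose * A = 0 := by
    ext j k
    simpa [Matrix.mul_apply] using h j k
  have hr : colSpan A = LinearMap.range A.mulVecLin := (Matrix.range_mulVecLin A).symm
  rw [hr] at hx hy
  obtain ⟨u, rfl⟩ := hx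
  obtain ⟨v, rfl⟩ := hy
  change (A.mulVec u) ⬝ᵥ (A.mulVec v) = 0
  rw [Matrix.dotProduct_mulVec, ← Matrix.mulVec_transpose, Matrix.mulVec_mulVec, h0]
  simp

lemma core (k l : ℕ) (A : Matrix (Fin (2*(k+l))) (Fin (k+l)) (ZMod 2))
    (hA : MemM (k+l) A)
    (b : Fin k → Fin (2*(k+l)) → ZMod 2) (c : Fin l → Fin (2*(k+l)) → ZMod 2)
    (hb : LinearIndependent (ZMod 2) b) (hc : LinearIndependent (ZMod 2) c)
    (hd : Disjoint (Submodule.span (ZMod 2) (Set.range b)) (Submodule.span (ZMod 2) (Set.range c)))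
    (hbA : ∀ j, b j ∈ colSpan A) (hcA : ∀ j, c j ∈ colSpan A)
    (hbc : ∀ j j' i, b j i * c j' i = 0) :
    ∃ (B : Matrix (Fin (2*k)) (Fin k) (ZMod 2))
      (C : Matrix (Fin (2*l)) (Fin l) (ZMod 2)),
      MemM k B ∧ MemM l C ∧ EquivMat (k+l) A (blockDiag2 B C) := by
  classical
  let P : Fin (2*(k+l)) → Prop := fun i => ∃ j, b j i ≠ 0
  have hcP : ∀ i, P i → ∀ j, c j i = 0 := by
    rintro i ⟨j, hj⟩ j'
    have := hbc j j' i
    simpa [hj] using this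
  have hbP : ∀ i, ¬ P i → ∀ j, b j i = 0 := by
    intro i hi j
    by_contra h
    exact hi ⟨j, h⟩
  have horth := orth_of_colSpan A hA.2
  have hob : ∀ j j', ∑ i, b j i * b j' i = 0 := fun j j' => horth _ _ (hbA j) (hbA j')
  have hoc : ∀ j j', ∑ i, c j i * c j' i = 0 := fun j j' => horth _ _ (hcA j) (hcA j')
  have key1 : ∀ m (e : Fin m ≃ {i // P i}), ∀ i, i ∉ Set.range (fun a => (e a : Fin (2*(k+l)))) →
      ¬ P i := by
    intro m e i hi hP
    exact hi ⟨e.symm ⟨i, hP⟩, by simp⟩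
  have key2 : ∀ m (e : Fin m ≃ {i // ¬ P i}), ∀ i, i ∉ Set.range (fun a => (e a : Fin (2*(k+l)))) →
      P i := by
    intro m e i hi
    by_contra hP
    exact hi ⟨e.symm ⟨i, hP⟩, by simp⟩
  have hsum := Fintype.card_subtype_compl P
  have hle := Fintype.card_subtype_le P
  have h1 : 2 * k ≤ Fintype.card {i // P i} := by
    let e := (Fintype.equivFin {i // P i}).symm
    exact two_mul_le' b hb (fun a => (e a : Fin (2*(k+l))))
      (Subtype.val_injective.comp e.injective) hob (fun i hi => hbP i (key1 _ e i hi))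
  have h2 : 2 * l ≤ Fintype.card {i // ¬ P i} := by
    let e := (Fintype.equivFin {i // ¬ P i}).symm
    exact two_mul_le' c hc (fun a => (e a : Fin (2*(k+l))))
      (Subtype.val_injective.comp e.injective) hoc (fun i hi => hcP i (key2 _ e i hi))
  rw [Fintype.card_fin] at hsum hle
  have c1 : Fintype.card {i // P i} = 2 * k := by omega
  have c2 : Fintype.card {i // ¬ P i} = 2 * l := by omega
  let e1 : Fin (2*k) ≃ {i // P i} := (Fintype.equivFinOfCardEq c1).symm
  let e2 : Fin (2*l) ≃ {i // ¬ P i} := (Fintype.equivFinOfCardEq c2).symm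
  let τ : Fin (2*(k+l)) ≃ Fin (2*(k+l)) :=
    ((finCongr (by ring : 2*(k+l) = 2*k+2*l)).trans finSumFinEquiv.symm).trans
      ((Equiv.sumCongr e1 e2).trans (Equiv.sumCompl P))
  have hτ1 : ∀ (i : Fin (2*(k+l))) (h : (i:ℕ) < 2*k), τ i = (e1 ⟨i, h⟩ : Fin (2*(k+l))) := by
    intro i h
    have : finSumFinEquiv.symm (finCongr (by ring : 2*(k+l) = 2*k+2*l) i) = Sum.inl ⟨i, h⟩ := by
      rw [Equiv.symm_apply_eq]
      ext
      simp
    simp only [τ, Equiv.trans_apply, this]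
    simp
  have hτ2 : ∀ (i : Fin (2*(k+l))) (h : ¬ (i:ℕ) < 2*k),
      τ i = (e2 ⟨i - 2*k, by have := i.isLt; omega⟩ : Fin (2*(k+l))) := by
    intro i h
    have : finSumFinEquiv.symm (finCongr (by ring : 2*(k+l) = 2*k+2*l) i)
        = Sum.inr ⟨i - 2*k, by have := i.isLt; omega⟩ := by
      rw [Equiv.symm_apply_eq]
      ext
      simp
      omega
    simp only [τ, Equiv.trans_apply, this]
    simp
  have hB := memM_aux b hb (fun a => (e1 a : Fin (2*(k+l))))
      (Subtype.val_injective.comp e1.injective) hob (fun i hi => hbP i (key1 _ e1 i hi))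
  have hC := memM_aux c hc (fun a => (e2 a : Fin (2*(k+l))))
      (Subtype.val_injective.comp e2.injective) hoc (fun i hi => hcP i (key2 _ e2 i hi))
  -- the matrix of all the basis vectors
  let d : Fin (k+l) → Fin (2*(k+l)) → ZMod 2 := fun j => Sum.elim b c (finSumFinEquiv.symm j)
  have hdi : LinearIndependent (ZMod 2) d :=
    (LinearIndependent.sum_type hb hc hd).comp _ finSumFinEquiv.symm.injective
  have hdA : ∀ j, ∃ u, A.mulVec u = d j := by
    intro j
    have : d j ∈ colSpan A := by
      simp only [d]
      rcases finSumFinEquiv.symm j with a | a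
      · exact hbA a
      · exact hcA a
    rw [show colSpan A = LinearMap.range A.mulVecLin from (Matrix.range_mulVecLin A).symm] at this
    exact this
  choose u hu using hdA
  let lam : Matrix (Fin (k+l)) (Fin (k+l)) (ZMod 2) := Matrix.of fun i j => u j i
  have hAl : A * lam = Matrix.of fun i j => d j i := by
    ext i j
    rw [Matrix.of_apply, ← hu j]
    rfl
  refine ⟨_, _, ⟨hB.1, hB.2⟩, ⟨hC.1, hC.2⟩, τ.symm, lam, ?_, ?_⟩
  · rw [← Matrix.linearIndependent_cols_iff_isUnit, Fintype.linearIndependent_iff]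
    intro g hg
    rw [Fintype.linearIndependent_iff] at hdi
    apply hdi g
    have h3 : lam.mulVec g = 0 := by
      rw [← hg]
      ext i
      simp [Matrix.mulVec, dotProduct, mul_comm]
    have h4 : (A * lam).mulVec g = 0 := by rw [← Matrix.mulVec_mulVec, h3, Matrix.mulVec_zero]
    rw [hAl] at h4
    rw [← h4]
    ext i
    simp [Matrix.mulVec, dotProduct, mul_comm]
  · rw [Matrix.mul_assoc, hAl]
    ext i j
    rw [permMat_mul, Equiv.symm_symm, Matrix.of_apply]
    obtain ⟨j, rfl⟩ := finSumFinEquiv.surjective j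
    simp only [d, Equiv.symm_apply_apply, blockDiag2, Matrix.of_apply]
    by_cases hi : (i:ℕ) < 2*k
    · rw [hτ1 i hi]
      rcases j with j | j
      · simp [hi]
      · simpa [hi] using hcP _ (e1 ⟨i, hi⟩).2 j
    · rw [hτ2 i hi]
      rcases j with j | j
      · simpa [hi] using hbP _ (e2 ⟨i - 2*k, by have := i.isLt; omega⟩).2 j
      · simp [hi]

/-- if A ∈ ℳ_r is not irreducible then A is equivalent to a
block-diagonal matrix diag(B, C) with B ∈ ℳ_k, C ∈ ℳ_l and k + l = r. -/
theorem stmt13 (r : ℕ) (hr : 0 < r) (A : Matrix (Fin (2*r)) (Fin r) (ZMod 2))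
    (hA : MemM r A) (hirr : ¬ IrredMat A) :
    ∃ (k l : ℕ) (hkl : k + l = r) (B : Matrix (Fin (2*k)) (Fin k) (ZMod 2))
      (C : Matrix (Fin (2*l)) (Fin l) (ZMod 2)),
      0 < k ∧ 0 < l ∧ MemM k B ∧ MemM l C ∧
        EquivMat r A
          (Matrix.reindex (finCongr (by omega : 2*(k+l) = 2*r)) (finCongr hkl)
            (blockDiag2 B C)) := by
  unfold IrredMat at hirr
  rw [not_not] at hirr
  obtain ⟨n, W, hn, hne, hprod, hsup, hdis⟩ := hirr
  let i0 : Fin n := ⟨0, by omega⟩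
  let i1 : Fin n := ⟨1, hn⟩
  let U := W i0
  let V := ⨆ j ∈ ({i0}ᶜ : Set (Fin n)), W j
  have hUV : Disjoint U V := hdis i0
  have hWV : ∀ j, j ≠ i0 → W j ≤ V := fun j hj => le_iSup₂_of_le j hj le_rfl
  have hVne : V ≠ ⊥ := by
    intro h
    have : W i1 ≤ ⊥ := h ▸ hWV i1 (by simp [i0, i1])
    exact hne i1 (le_bot_iff.mp this)
  have hUVS : U ⊔ V = colSpan A := by
    rw [← hsup]
    apply le_antisymm
    · exact sup_le (le_iSup W i0) (iSup₂_le fun j _ => le_iSup W j)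
    · refine iSup_le fun j => ?_
      by_cases hj : j = i0
      · subst hj
        exact le_sup_left
      · exact (hWV j hj).trans le_sup_right
  have hUVp : ∀ x ∈ U, ∀ y ∈ V, x * y = 0 := by
    intro x hx y hy
    have hle : V ≤ LinearMap.ker (LinearMap.mulLeft (ZMod 2) x) := by
      refine iSup₂_le fun j hj z hz => ?_
      exact hprod i0 j (fun h => hj h.symm) x hx z hz
    exact hle hy
  have hfr : Module.finrank (ZMod 2) U + Module.finrank (ZMod 2) V = r := by
    have h1 := Submodule.finrank_sup_add_finrank_inf_eq U V
    rw [hUV.eq_bot, finrank_bot, hUVS] at h1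
    have h2 : Module.finrank (ZMod 2) (colSpan A) = r := by
      have h3 := hA.1
      rw [Matrix.rank_eq_finrank_span_cols] at h3
      exact h3
    omega
  have hk : 0 < Module.finrank (ZMod 2) U :=
    Nat.pos_of_ne_zero fun h => hne i0 (Submodule.finrank_eq_zero.mp h)
  have hl : 0 < Module.finrank (ZMod 2) V :=
    Nat.pos_of_ne_zero fun h => hVne (Submodule.finrank_eq_zero.mp h)
  have bU := Module.finBasis (ZMod 2) U
  have bV := Module.finBasis (ZMod 2) V
  generalize Module.finrank (ZMod 2) U = k at *
  generalize Module.finrank (ZMod 2) V = l at *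
  subst hfr
  have sU : Submodule.span (ZMod 2) (Set.range fun j => (bU j : Fin (2*(k+l)) → ZMod 2)) ≤ U := by
    rw [Submodule.span_le]
    rintro _ ⟨j, rfl⟩
    exact (bU j).2
  have sV : Submodule.span (ZMod 2) (Set.range fun j => (bV j : Fin (2*(k+l)) → ZMod 2)) ≤ V := by
    rw [Submodule.span_le]
    rintro _ ⟨j, rfl⟩
    exact (bV j).2
  obtain ⟨B, C, hB, hC, h⟩ := core k l A hA (fun j => (bU j : Fin (2*(k+l)) → ZMod 2))
    (fun j => (bV j : Fin (2*(k+l)) → ZMod 2))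
    (bU.linearIndependent.map' U.subtype U.ker_subtype)
    (bV.linearIndependent.map' V.subtype V.ker_subtype)
    (hUV.mono sU sV)
    (fun j => hUVS ▸ (le_sup_left : U ≤ U ⊔ V) (bU j).2)
    (fun j => hUVS ▸ (le_sup_right : V ≤ U ⊔ V) (bV j).2)
    (fun j j' i => congrFun (hUVp _ (bU j).2 _ (bV j').2) i)
  exact ⟨k, l, rfl, B, C, hk, hl, hB, hC, h⟩
end

section
/- Let r be a positive integer and A = (v₁,…,v_r) ∈ ℳ_r. If dim 𝒳(A) = 2r−1, then A is irreducible. -/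
/-- 𝒳(A) = Span{vᵢ∘vⱼ : 1 ≤ i,j ≤ r}, where the vᵢ are the columns of A. -/
def XSpan {N r : ℕ} (A : Matrix (Fin N) (Fin r) (ZMod 2)) :
    Submodule (ZMod 2) (Fin N → ZMod 2) :=
  Submodule.span (ZMod 2) {x | ∃ j k : Fin r, x = fun i => A i j * A i k}

/-- if A ∈ ℳ_r and dim 𝒳(A) = 2r−1, then A is irreducible. -/
theorem stmt14 (r : ℕ) (hr : 0 < r) (A : Matrix (Fin (2*r)) (Fin r) (ZMod 2))
    (hA : MemM r A) (hdim : Module.finrank (ZMod 2) (XSpan A) = 2*r - 1) :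
    IrredMat A := by
  have hle : XSpan A ≤ VS (2*r) := by
    refine Submodule.span_le.2 ?_
    rintro x ⟨j, k, rfl⟩
    exact hA.2 j k
  have hlt : VS (2*r) < ⊤ := by
    refine lt_top_iff_ne_top.2 fun h => ?_
    have h1 : (Pi.single (⟨0, by omega⟩ : Fin (2*r)) 1 : Fin (2*r) → ZMod 2) ∈ VS (2*r) := by
      rw [h]; trivial
    rw [mem_VS] at h1
    simp at h1
  have hfr := Submodule.finrank_lt hlt.ne
  rw [Module.finrank_fin_fun] at hfr
  have hX : XSpan A = VS (2*r) := Submodule.eq_of_le_of_finrank_le hle (by omega)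
  rintro ⟨l, W, hl, hne, hmul, hsup, -⟩
  obtain ⟨x, hx, hx0⟩ := Submodule.exists_mem_ne_zero_of_ne_bot (hne ⟨0, by omega⟩)
  obtain ⟨y, hy, hy0⟩ := Submodule.exists_mem_ne_zero_of_ne_bot (hne ⟨1, hl⟩)
  obtain ⟨p, hp⟩ := Function.ne_iff.1 hx0
  obtain ⟨q, hq⟩ := Function.ne_iff.1 hy0
  classical
  set z : Fin l := ⟨0, by omega⟩ with hz
  let s : Fin (2*r) → ZMod 2 := fun i => if ∃ x ∈ W z, x i ≠ 0 then 1 else 0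
  have hvan : ∀ j, j ≠ z → ∀ a ∈ W j, ∀ i, (∃ x ∈ W z, x i ≠ 0) → a i = 0 := by
    rintro j hj a ha i ⟨w, hw, hwi⟩
    have := congrFun (hmul j z hj a ha w hw) i
    exact (mul_eq_zero.1 this).resolve_right hwi
  have hsa : ∀ a ∈ colSpan A, s * a ∈ W z := by
    intro a ha
    rw [← hsup] at ha
    induction ha using Submodule.iSup_induction' with
    | mem j a ha =>
      by_cases hj : j = z
      · subst hj
        have : s * a = a := by
          funext i
          by_cases h : a i = 0
          · simp [h]
          · have h2 : ∃ x ∈ W z, x i ≠ 0 := ⟨a, ha, h⟩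
            simp only [Pi.mul_apply, s, if_pos h2, one_mul]
        rwa [this]
      · have : s * a = 0 := by
          funext i
          by_cases h : ∃ x ∈ W z, x i ≠ 0
          · simp [hvan j hj a ha i h]
          · simp only [Pi.mul_apply, s, if_neg h, zero_mul, Pi.zero_apply]
        rw [this]; exact zero_mem _
    | zero => rw [mul_zero]; exact zero_mem _
    | add a b _ _ h1 h2 => rw [mul_add]; exact add_mem h1 h2
  have hab : ∀ a ∈ colSpan A, ∀ b ∈ colSpan A, a * b ∈ VS (2*r) := by
    intro a ha b hb
    unfold colSpan at ha hb
    induction ha, hb using Submodule.span_induction₂ with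
    | mem_mem a b ha hb =>
      obtain ⟨j, rfl⟩ := ha
      obtain ⟨k, rfl⟩ := hb
      exact hA.2 j k
    | zero_left => rw [zero_mul]; exact zero_mem _
    | zero_right => rw [mul_zero]; exact zero_mem _
    | add_left _ _ _ _ _ _ h1 h2 => rw [add_mul]; exact add_mem h1 h2
    | add_right _ _ _ _ _ _ h1 h2 => rw [mul_add]; exact add_mem h1 h2
    | smul_left c _ _ _ _ h => rw [smul_mul_assoc]; exact Submodule.smul_mem _ c h
    | smul_right c _ _ _ _ h => rw [mul_smul_comm]; exact Submodule.smul_mem _ c h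
  have hWle : W z ≤ colSpan A := hsup ▸ le_iSup W z
  have hcol : ∀ j, (fun i => A i j) ∈ colSpan A := fun j => Submodule.subset_span ⟨j, rfl⟩
  have hphi : ∀ w ∈ XSpan A, s * w ∈ VS (2*r) := by
    intro w hw
    unfold XSpan at hw
    induction hw using Submodule.span_induction with
    | mem w hw =>
      obtain ⟨j, k, rfl⟩ := hw
      have := hab _ (hWle (hsa _ (hcol j))) _ (hcol k)
      rw [mul_assoc] at this
      exact this
    | zero => rw [mul_zero]; exact zero_mem _
    | add a b _ _ h1 h2 => rw [mul_add]; exact add_mem h1 h2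
    | smul c a _ h => rw [mul_smul_comm]; exact Submodule.smul_mem _ c h
  have hsp : s p = 1 := if_pos ⟨x, hx, hp⟩
  have hsq : s q = 0 := if_neg fun h => hq (hvan ⟨1, hl⟩ (by simp [hz]) y hy q h)
  have hmem : (Pi.single p 1 + Pi.single q 1 : Fin (2*r) → ZMod 2) ∈ XSpan A := by
    rw [hX, mem_VS]
    simp only [Pi.add_apply, Finset.sum_add_distrib, Finset.sum_pi_single', Finset.mem_univ, if_true]
    decide
  have hfin := hphi _ hmem
  rw [mem_VS] at hfin
  simp [mul_add, Finset.sum_add_distrib, Pi.single_apply, hsp, hsq] at hfin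
end

section
/- Let r be a positive integer and A ∈ ℳ_r with dim 𝒳(A) = r. Then A is equivalent to the 2r×r matrix consisting of the identity I_r stacked on top of I_r, i.e. there exist a 2r×2r permutation matrix σ and λ ∈ GL(r,𝔽₂) with σAλ equal to this stacked matrix; consequently, if r ≥ 2 then A is not irreducible. -/
open Classical in
noncomputable def cls17 {n : ℕ} (C : Submodule (ZMod 2) (Fin n → ZMod 2)) (i : Fin n) :
    Fin n → ZMod 2 := fun j => if ∀ x ∈ C, x i = x j then 1 else 0

lemma z2_17 (a : ZMod 2) : a = 0 ∨ a = 1 := by revert a; decide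

lemma cls17_mem {n : ℕ} (C : Submodule (ZMod 2) (Fin n → ZMod 2))
    (hC : ∀ x ∈ C, ∀ y ∈ C, x * y ∈ C) (i : Fin n) (hi : ∃ x ∈ C, x i ≠ 0) :
    cls17 C i ∈ C := by
  classical
  obtain ⟨x0, hx0, hx0i⟩ := hi
  let S : Finset (Fin n → ZMod 2) := Finset.univ.filter fun x => x ∈ C ∧ x i = 1
  have hx0S : x0 ∈ S := by
    simp only [S, Finset.mem_filter, Finset.mem_univ, true_and]
    exact ⟨hx0, (z2_17 _).resolve_left hx0i⟩
  have hf : (∏ x ∈ S, x) ∈ C := by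
    apply Finset.prod_induction_nonempty (fun x => x) (fun x => x ∈ C)
    · intro a b ha hb; exact hC a ha b hb
    · exact ⟨x0, hx0S⟩
    · intro x hx; exact (Finset.mem_filter.1 hx).2.1
  have key : cls17 C i = ∏ x ∈ S, x := by
    funext j
    rw [Finset.prod_apply]
    have hfi : (∏ x ∈ S, x) i = 1 := by
      rw [Finset.prod_apply]
      exact Finset.prod_eq_one fun x hx => (Finset.mem_filter.1 hx).2.2
    unfold cls17
    split_ifs with h
    · symm
      apply Finset.prod_eq_one
      intro x hx
      obtain ⟨h1, h2⟩ := (Finset.mem_filter.1 hx).2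
      rw [← h x h1, h2]
    · push Not at h
      obtain ⟨x, hx, hne⟩ := h
      symm
      rcases z2_17 (x i) with h0 | h1
      · have hj : x j = 1 := (z2_17 _).resolve_left (fun h => hne (by rw [h0, h]))
        have hy : (∏ x ∈ S, x) + (∏ x ∈ S, x) * x ∈ S := by
          simp only [S, Finset.mem_filter, Finset.mem_univ, true_and]
          refine ⟨C.add_mem hf (hC _ hf _ hx), ?_⟩
          rw [Pi.add_apply, Pi.mul_apply, h0, hfi]; simp
        apply Finset.prod_eq_zero hy
        rw [Pi.add_apply, Pi.mul_apply, hj, mul_one]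
        exact CharTwo.add_self_eq_zero _
      · have hj : x j = 0 := (z2_17 _).resolve_right (fun h => hne (by rw [h1, h]))
        have hy : x ∈ S := by
          simp only [S, Finset.mem_filter, Finset.mem_univ, true_and]
          exact ⟨hx, h1⟩
        exact Finset.prod_eq_zero hy hj
  rw [key]; exact hf

lemma cls17_eq {n : ℕ} (C : Submodule (ZMod 2) (Fin n → ZMod 2)) (i j : Fin n)
    (h : cls17 C i j ≠ 0) : cls17 C i = cls17 C j := by
  have h' : ∀ x ∈ C, x i = x j := by
    by_contra hc; exact h (by unfold cls17; rw [if_neg hc])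
  funext k
  unfold cls17
  congr 1
  apply propext
  constructor
  · intro hh x hx; rw [← h' x hx, hh x hx]
  · intro hh x hx; rw [h' x hx, hh x hx]

lemma cls17_self {n : ℕ} (C : Submodule (ZMod 2) (Fin n → ZMod 2)) (i : Fin n) :
    cls17 C i i = 1 := by simp [cls17]

lemma struct17 (r : ℕ) (C : Submodule (ZMod 2) (Fin (2*r) → ZMod 2))
    (hC : ∀ x ∈ C, ∀ y ∈ C, x * y ∈ C) (hV : C ≤ VS (2*r))
    (hdim : Module.finrank (ZMod 2) C = r) :
    ∃ (g : Fin r → Fin (2*r) → ZMod 2) (a b : Fin r → Fin (2*r)),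
      Submodule.span (ZMod 2) (Set.range g) = C ∧ (∀ k, a k ≠ b k) ∧
      (∀ k j, g k j ≠ 0 ↔ j = a k ∨ j = b k) ∧
      (∀ k l j, g k j ≠ 0 → g l j ≠ 0 → k = l) := by
  classical
  let I : Finset (Fin (2*r)) := Finset.univ.filter fun i => ∃ x ∈ C, x i ≠ 0
  have hI : ∀ i, i ∈ I ↔ ∃ x ∈ C, x i ≠ 0 := by intro i; simp [I]
  let F : Finset (Fin (2*r) → ZMod 2) := I.image (cls17 C)
  have hFC : ∀ g ∈ F, g ∈ C := by
    intro g hg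
    obtain ⟨i, hi, rfl⟩ := Finset.mem_image.1 hg
    exact cls17_mem C hC i ((hI i).1 hi)
  have hFj : ∀ g ∈ F, ∀ j, g j ≠ 0 → g = cls17 C j := by
    intro g hg j hj
    obtain ⟨i, hi, rfl⟩ := Finset.mem_image.1 hg
    exact cls17_eq C i j hj
  have hspan : Submodule.span (ZMod 2) (F : Set (Fin (2*r) → ZMod 2)) = C := by
    apply le_antisymm
    · rw [Submodule.span_le]; exact hFC
    · intro x hx
      have hxe : x = ∑ g ∈ (I.filter fun i => x i ≠ 0).image (cls17 C), g := by
        funext j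
        rw [Finset.sum_apply]
        rcases z2_17 (x j) with h0 | h1
        · rw [h0]; symm
          apply Finset.sum_eq_zero
          intro g hg
          obtain ⟨i, hi, rfl⟩ := Finset.mem_image.1 hg
          have hi2 := (Finset.mem_filter.1 hi).2
          unfold cls17
          rw [if_neg]
          intro h; exact hi2 (by rw [h x hx, h0])
        · have hj : x j ≠ 0 := by rw [h1]; exact one_ne_zero
          rw [Finset.sum_eq_single (cls17 C j), cls17_self, h1]
          · intro g hg hne
            by_contra hgj
            apply hne
            obtain ⟨i, hi, rfl⟩ := Finset.mem_image.1 hg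
            exact cls17_eq C i j hgj
          · intro h
            exact absurd (Finset.mem_image_of_mem _
              (Finset.mem_filter.2 ⟨(hI j).2 ⟨x, hx, hj⟩, hj⟩)) h
      rw [hxe]
      apply Submodule.sum_mem
      intro g hg
      apply Submodule.subset_span
      exact Finset.image_subset_image (Finset.filter_subset _ _) hg
  have hcard : r ≤ F.card := by
    have := finrank_span_finset_le_card (R := ZMod 2) F
    rw [Set.finrank, hspan, hdim] at this
    exact this
  let supp : (Fin (2*r) → ZMod 2) → Finset (Fin (2*r)) := fun g => Finset.univ.filter fun j => g j ≠ 0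
  have hsupp : ∀ g j, j ∈ supp g ↔ g j ≠ 0 := by intro g j; simp [supp]
  have h2 : ∀ g ∈ F, 2 ≤ (supp g).card := by
    intro g hg
    have hs : ∑ j, g j = 0 := hV (hFC g hg)
    have hc : ∑ j, g j = ((supp g).card : ZMod 2) := by
      rw [Finset.card_filter, Nat.cast_sum]
      apply Finset.sum_congr rfl
      intro j _
      rcases z2_17 (g j) with h | h <;> simp [h]
    rw [hs] at hc
    have hd : 2 ∣ (supp g).card := (ZMod.natCast_eq_zero_iff _ _).1 hc.symm
    apply Nat.le_of_dvd _ hd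
    obtain ⟨i, hi, rfl⟩ := Finset.mem_image.1 hg
    apply Finset.card_pos.2
    exact ⟨i, (hsupp _ _).2 (by rw [cls17_self]; exact one_ne_zero)⟩
  have hsum : ∑ g ∈ F, (supp g).card ≤ 2 * r := by
    rw [← Finset.card_biUnion]
    · simpa using Finset.card_le_univ (F.biUnion supp)
    · intro g hg g' hg' hne
      apply Finset.disjoint_left.2
      intro j hj hj'
      exact hne ((hFj g hg j ((hsupp _ _).1 hj)).trans (hFj g' hg' j ((hsupp _ _).1 hj')).symm)
  have hge : ∑ g ∈ F, 2 ≤ ∑ g ∈ F, (supp g).card := Finset.sum_le_sum h2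
  have hFr : F.card = r := by
    rw [Finset.sum_const, smul_eq_mul] at hge; omega
  have heq : ∀ g ∈ F, 2 = (supp g).card := by
    apply (Finset.sum_eq_sum_iff_of_le h2).1
    rw [Finset.sum_const, smul_eq_mul] at hge ⊢; omega
  let e := F.equivFinOfCardEq hFr
  have hab : ∀ k : Fin r, ∃ a b, a ≠ b ∧ supp (e.symm k).1 = {a, b} := fun k =>
    Finset.card_eq_two.1 (heq _ (e.symm k).2).symm
  choose a b hne hs using hab
  refine ⟨fun k => (e.symm k).1, a, b, ?_, hne, ?_, ?_⟩
  · rw [← hspan]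
    congr 1
    ext x
    constructor
    · rintro ⟨k, rfl⟩; exact (e.symm k).2
    · intro hx; exact ⟨e ⟨x, hx⟩, by simp⟩
  · intro k j
    rw [← hsupp, hs]; simp
  · intro k l j hk hl
    have := (hFj _ (e.symm k).2 j hk).trans (hFj _ (e.symm l).2 j hl).symm
    exact e.symm.injective (Subtype.ext this)

/-- if A ∈ ℳ_r and dim 𝒳(A) = r, then A is equivalent to the matrix
I_r stacked on I_r; consequently if r ≥ 2 then A is not irreducible. -/
theorem stmt17 (r : ℕ) (hr : 0 < r) (A : Matrix (Fin (2*r)) (Fin r) (ZMod 2))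
    (hA : MemM r A) (hdim : Module.finrank (ZMod 2) (XSpan A) = r) :
    EquivMat r A (stack (1 : Matrix (Fin r) (Fin r) (ZMod 2)) 1) ∧
      (2 ≤ r → ¬ IrredMat A) := by
  classical
  obtain ⟨hrank, hsum⟩ := hA
  have hCdim : Module.finrank (ZMod 2) (colSpan A) = r := by
    refine Eq.trans ?_ hrank
    rw [Matrix.rank_eq_finrank_span_cols]; rfl
  have hle : colSpan A ≤ XSpan A := by
    unfold colSpan
    rw [Submodule.span_le]
    rintro _ ⟨j, rfl⟩
    apply Submodule.subset_span
    refine ⟨j, j, ?_⟩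
    funext i
    rcases z2_17 (A i j) with h | h <;> simp [h]
  have hCX : colSpan A = XSpan A := Submodule.eq_of_le_of_finrank_eq hle (by rw [hCdim, hdim])
  have hV : colSpan A ≤ VS (2*r) := by
    rw [hCX]; unfold XSpan; rw [Submodule.span_le]
    rintro _ ⟨j, k, rfl⟩; exact hsum j k
  have hmul : ∀ x ∈ colSpan A, ∀ y ∈ colSpan A, x * y ∈ colSpan A := by
    intro x hx y hy
    unfold colSpan at hx hy
    induction hx, hy using Submodule.span_induction₂ with
    | mem_mem x y hx hy =>
      obtain ⟨j, rfl⟩ := hx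
      obtain ⟨k, rfl⟩ := hy
      rw [hCX]
      exact Submodule.subset_span ⟨j, k, rfl⟩
    | zero_left y hy => rw [zero_mul]; exact Submodule.zero_mem _
    | zero_right x hx => rw [mul_zero]; exact Submodule.zero_mem _
    | add_left x y z _ _ _ h1 h2 => rw [add_mul]; exact Submodule.add_mem _ h1 h2
    | add_right x y z _ _ _ h1 h2 => rw [mul_add]; exact Submodule.add_mem _ h1 h2
    | smul_left c x y _ _ h => rw [smul_mul_assoc]; exact Submodule.smul_mem _ _ h
    | smul_right c x y _ _ h => rw [mul_smul_comm]; exact Submodule.smul_mem _ _ h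
  obtain ⟨g, a, b, hspan, hab, hg, hdisj⟩ := struct17 r (colSpan A) hmul hV hCdim
  have hga : ∀ k, g k (a k) ≠ 0 := fun k => (hg k _).2 (Or.inl rfl)
  have hgb : ∀ k, g k (b k) ≠ 0 := fun k => (hg k _).2 (Or.inr rfl)
  have one_of : ∀ c : ZMod 2, c ≠ 0 → c = 1 := fun c h => (z2_17 c).resolve_left h
  have hga' : ∀ k l, g l (a k) = if k = l then 1 else 0 := by
    intro k l
    split_ifs with h
    · subst h; exact one_of _ (hga k)
    · by_contra hc; exact h (hdisj k l _ (hga k) hc)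
  have hgb' : ∀ k l, g l (b k) = if k = l then 1 else 0 := by
    intro k l
    split_ifs with h
    · subst h; exact one_of _ (hgb k)
    · by_contra hc; exact h (hdisj k l _ (hgb k) hc)
  constructor
  · -- the permutation
    let τ : Fin (2*r) → Fin (2*r) := fun i =>
      if h : (i : ℕ) < r then a ⟨i, h⟩ else b ⟨(i : ℕ) - r, by have := i.isLt; omega⟩
    have hτ : Function.Injective τ := by
      intro i j hij
      simp only [τ] at hij
      split_ifs at hij with h1 h2 h2
      · have := hdisj _ _ _ (hga ⟨i, h1⟩) (by rw [hij]; exact hga _)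
        rw [Fin.mk.injEq] at this
        exact Fin.ext this
      · exfalso
        have := hdisj _ _ _ (hga ⟨i, h1⟩) (by rw [hij]; exact hgb _)
        rw [← this] at hij; exact hab _ hij
      · exfalso
        have := hdisj _ _ _ (hgb ⟨i - r, by have := i.isLt; omega⟩) (by rw [hij]; exact hga _)
        rw [← this] at hij; exact hab _ hij.symm
      · have := hdisj _ _ _ (hgb ⟨i - r, by have := i.isLt; omega⟩) (by rw [hij]; exact hgb _)
        rw [Fin.mk.injEq] at this
        apply Fin.ext; omega
    let ρ : Equiv.Perm (Fin (2*r)) := Equiv.ofBijective τ (Finite.injective_iff_bijective.1 hτ)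
    have hlam : ∀ k, ∃ v : Fin r → ZMod 2, A.mulVec v = g k := by
      intro k
      have : g k ∈ colSpan A := by rw [← hspan]; exact Submodule.subset_span ⟨k, rfl⟩
      have h2 : g k ∈ LinearMap.range A.mulVecLin := by
        rw [Matrix.range_mulVecLin]; exact this
      exact h2
    choose v hv using hlam
    let lam : Matrix (Fin r) (Fin r) (ZMod 2) := Matrix.of fun j k => v k j
    have hAl : ∀ i k, (A * lam) i k = g k i := by
      intro i k; rw [← hv k]; rfl
    refine ⟨ρ.symm, lam, ?_, ?_⟩
    · let P : Matrix (Fin r) (Fin r) (ZMod 2) := A.submatrix a id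
      have hP : P * lam = 1 := by
        ext k l
        have : (P * lam) k l = (A * lam) (a k) l := rfl
        rw [this, hAl, hga', Matrix.one_apply]
      exact IsUnit.of_mul_eq_one_right P hP
    · rw [Matrix.mul_assoc]
      ext i k
      have : (permMat ρ.symm * (A * lam)) i k = (A * lam) (ρ i) k := by
        rw [Matrix.mul_apply, Finset.sum_eq_single (ρ i)]
        · simp [permMat]
        · intro j _ hj
          have : ρ.symm j ≠ i := fun h => hj (by rw [← h]; simp)
          simp [permMat, this]
        · simp
      rw [this, hAl]
      have hρ : ρ i = τ i := rfl
      rw [hρ]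
      simp only [τ, stack, Matrix.of_apply]
      split_ifs with h
      · rw [hga', Matrix.one_apply]
      · rw [hgb', Matrix.one_apply]
  · intro h2 hirr
    apply hirr
    have hprod : ∀ i j, i ≠ j → ∀ x ∈ Submodule.span (ZMod 2) {g i},
        ∀ y ∈ Submodule.span (ZMod 2) {g j}, x * y = 0 := by
      intro i j hij x hx y hy
      obtain ⟨c, rfl⟩ := Submodule.mem_span_singleton.1 hx
      obtain ⟨d, rfl⟩ := Submodule.mem_span_singleton.1 hy
      have : g i * g j = 0 := by
        funext t
        rw [Pi.mul_apply, Pi.zero_apply]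
        by_contra hc
        exact hij (hdisj i j t (left_ne_zero_of_mul hc) (right_ne_zero_of_mul hc))
      rw [smul_mul_smul_comm, this, smul_zero]
    refine ⟨r, fun k => Submodule.span (ZMod 2) {g k}, h2, ?_, hprod, ?_, ?_⟩
    · intro k hk
      rw [Submodule.span_singleton_eq_bot] at hk
      exact hga k (by rw [hk]; rfl)
    · rw [← hspan, ← Submodule.span_iUnion]
      congr 1
      ext x; simp [eq_comm]
    · intro i
      rw [Submodule.disjoint_def]
      intro x hx hx'
      have hle : (⨆ j ∈ ({i}ᶜ : Set (Fin r)), Submodule.span (ZMod 2) {g j})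
          ≤ LinearMap.ker (LinearMap.mulLeft (ZMod 2) x) := by
        apply iSup₂_le
        intro j hj y hy
        rw [LinearMap.mem_ker, LinearMap.mulLeft_apply]
        exact hprod i j (fun h => hj h.symm) x hx y hy
      have hxx : x * x = 0 := hle hx'
      funext t
      exact mul_self_eq_zero.1 (congrFun hxx t)
end

section
/- For r ∈ {2, 3, 5}, no matrix in ℳ_r is irreducible. -/
namespace S19

abbrev V (n : ℕ) := Fin n → ZMod 2

/-- Hamming weight as a natural number. -/
def wt {n : ℕ} (x : V n) : ℕ := ∑ i, (x i).val

lemma wt_add {n : ℕ} (x y : V n) : wt (x + y) + 2 * wt (x * y) = wt x + wt y := by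
  unfold wt
  rw [Finset.mul_sum, ← Finset.sum_add_distrib, ← Finset.sum_add_distrib]
  refine Finset.sum_congr rfl fun i _ => ?_
  have : ∀ a b : ZMod 2, (a + b).val + 2 * (a * b).val = a.val + b.val := by decide
  exact this _ _

lemma wt_eq_zero {n : ℕ} {x : V n} (h : wt x = 0) : x = 0 := by
  unfold wt at h
  rw [Finset.sum_eq_zero_iff] at h
  funext i
  exact (ZMod.val_eq_zero _).1 (h i (Finset.mem_univ _))

lemma wt_zero {n : ℕ} : wt (0 : V n) = 0 := by simp [wt]

lemma wt_one {n : ℕ} : wt (1 : V n) = n := by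
  simp [wt, ZMod.val_one]

lemma two_dvd_wt {n : ℕ} {x : V n} (h : ∑ i, x i = 0) : 2 ∣ wt x := by
  rw [← ZMod.natCast_eq_zero_iff]
  unfold wt
  push_cast
  simpa using h

lemma add_self {n : ℕ} (x : V n) : x + x = 0 := by
  funext i
  exact CharTwo.add_self_eq_zero _

lemma mul_self {n : ℕ} (x : V n) : x * x = x := by
  funext i
  have : ∀ a : ZMod 2, a * a = a := by decide
  exact this _

lemma wt_compl {n : ℕ} (x : V n) : wt (x + 1) + wt x = n := by
  have := wt_add x 1
  rw [mul_one, wt_one] at this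
  omega

/-- A weight two vector splits off. -/
lemma split {n : ℕ} {C : Submodule (ZMod 2) (V n)} (ho : ∀ x ∈ C, ∀ y ∈ C, ∑ i, (x * y) i = 0)
    {x : V n} (hx : x ∈ C) (hw : wt x = 2) {y : V n} (hy : y ∈ C) : x * y = 0 ∨ x * (x + y) = 0 := by
  have h1 := two_dvd_wt (ho x hx y hy)
  have h2 := wt_add (x * y) (x * (x + y))
  have e1 : x * y + x * (x + y) = x := by
    rw [mul_add, mul_self, add_comm x, ← add_assoc, add_self, zero_add]
  have e2 : x * y * (x * (x + y)) = 0 := by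
    have : x * y * (x * (x + y)) = x * x * (x * y) + x * x * (y * y) := by ring
    rw [this, mul_self, mul_self, ← mul_assoc, mul_self, add_self]
  rw [e1, e2, wt_zero, hw] at h2
  have : wt (x * y) = 0 ∨ wt (x * (x + y)) = 0 := by omega
  exact this.imp wt_eq_zero wt_eq_zero

lemma one_mem {r : ℕ} {C : Submodule (ZMod 2) (V (2 * r))} (hr : Module.finrank (ZMod 2) C = r)
    (ho : ∀ x ∈ C, ∀ y ∈ C, ∑ i, (x * y) i = 0) : (1 : V (2 * r)) ∈ C := by
  let B : LinearMap.BilinForm (ZMod 2) (V (2 * r)) := dotProductBilin (ZMod 2) (ZMod 2)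
  have hB : ∀ x y, B x y = ∑ i, (x * y) i := fun x y => rfl
  have hn : B.Nondegenerate := by
    refine ⟨fun x hx => ?_, fun x hx => ?_⟩ <;> funext i
    · simpa [hB, Pi.single_apply] using hx (Pi.single i 1)
    · simpa [hB, Pi.single_apply] using hx (Pi.single i 1)
  have hs : B.IsRefl := by
    intro x y h
    rw [hB] at *
    rw [← h]
    exact Finset.sum_congr rfl fun i _ => mul_comm _ _
  have hf := LinearMap.BilinForm.finrank_orthogonal hn C
  have hle : C ≤ B.orthogonal C := by
    intro x hx y hy
    exact ho y hy x hx
  have := Submodule.eq_of_le_of_finrank_eq hle (by rw [hf, hr]; simp; omega)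
  rw [this]
  intro y hy
  show B y 1 = 0
  rw [hB, mul_one, ← mul_self y]
  exact ho y hy y hy

open Classical in
lemma no_ten {C : Submodule (ZMod 2) (V 10)} (hc : (Finset.univ.filter (· ∈ C)).card = 32)
    (ho : ∀ x ∈ C, ∀ y ∈ C, ∑ i, (x * y) i = 0) (h1 : (1 : V 10) ∈ C)
    (h2 : ∀ x ∈ C, wt x ≠ 2) : False := by
  have hev : ∀ x ∈ C, 2 ∣ wt x := fun x hx => by
    have := two_dvd_wt (ho x hx x hx)
    rwa [mul_self] at this
  have hadd : ∀ x ∈ C, ∀ y ∈ C, 4 ∣ wt x → 4 ∣ wt y → 4 ∣ wt (x + y) := by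
    intro x hx y hy h h'
    have a := two_dvd_wt (ho x hx y hy)
    have b := wt_add x y
    omega
  obtain ⟨T, hT⟩ : ∃ T : Finset (V 10), ∀ x, x ∈ T ↔ x ∈ C ∧ 4 ∣ wt x :=
    ⟨(Finset.univ.filter (· ∈ C)).filter (fun x => 4 ∣ wt x), by simp⟩
  have hTc : T.card = 16 := by
    have e := Finset.card_filter_add_card_filter_not (s := Finset.univ.filter (· ∈ C)) (fun x => 4 ∣ wt x)
    rw [hc] at e
    have eT : (Finset.univ.filter (· ∈ C)).filter (fun x => 4 ∣ wt x) = T := by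
      ext x; simp [hT]
    have eT' : ((Finset.univ.filter (· ∈ C)).filter (fun x => ¬ 4 ∣ wt x)).card = T.card := by
      refine Finset.card_nbij' (· + 1) (· + 1) ?_ ?_ ?_ ?_
      · intro x hx
        simp at hx
        simp only [Finset.mem_coe, hT]
        refine ⟨C.add_mem hx.1 h1, ?_⟩
        have := wt_compl x
        have := hev x hx.1
        omega
      · intro x hx
        simp only [Finset.mem_coe, hT] at hx
        simp
        refine ⟨C.add_mem hx.1 h1, ?_⟩
        have := wt_compl x
        omega
      · intro x _
        simp [add_assoc, add_self]
      · intro x _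
        simp [add_assoc, add_self]
    rw [eT, eT'] at e
    omega
  have hi : ∀ i, 8 ∣ ∑ x ∈ T, (x i).val := by
    intro i
    by_cases h : ∃ t ∈ T, t i = 1
    · obtain ⟨t, ht, hti⟩ := h
      have e1 : ∑ x ∈ T, (x i).val = ∑ x ∈ T, ((x + t) i).val := by
        have ht' := (hT t).1 ht
        have key : ∀ x ∈ T, x + t ∈ T := fun x hx => by
          have hx' := (hT x).1 hx
          exact (hT _).2 ⟨C.add_mem hx'.1 ht'.1, hadd _ hx'.1 _ ht'.1 hx'.2 ht'.2⟩
        refine Finset.sum_nbij' (· + t) (· + t) key key ?_ ?_ ?_ <;> intro x _ <;>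
          simp only [add_assoc, add_self, add_zero]
      have e2 : ∑ x ∈ T, (x i).val + ∑ x ∈ T, ((x + t) i).val = 16 := by
        rw [← Finset.sum_add_distrib, ← hTc, Finset.card_eq_sum_ones]
        refine Finset.sum_congr rfl fun x _ => ?_
        have : ∀ a : ZMod 2, a.val + (a + 1).val = 1 := by decide
        rw [Pi.add_apply, hti]
        exact this _
      omega
    · rw [Finset.sum_eq_zero]
      · exact dvd_zero _
      · intro x hx
        have : ∀ a : ZMod 2, a ≠ 1 → a.val = 0 := by decide
        exact this _ fun h' => h ⟨x, hx, h'⟩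
  have hs : 8 ∣ ∑ x ∈ T, wt x := by
    unfold wt
    rw [Finset.sum_comm]
    exact Finset.dvd_sum fun i _ => hi i
  have h0 : (0 : V 10) ∈ T := (hT _).2 ⟨C.zero_mem, by simp [wt_zero]⟩
  have : ∑ x ∈ T, wt x = 60 := by
    rw [← Finset.sum_erase_add _ _ h0, wt_zero, Finset.sum_congr rfl (g := fun _ => 4)]
    · simp [Finset.card_erase_of_mem h0, hTc]
    · intro x hx
      rw [Finset.mem_erase, hT] at hx
      obtain ⟨hx0, hxC, hx4⟩ := hx
      have a := wt_compl x
      have b := h2 _ (C.add_mem hxC h1)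
      have c : wt x ≠ 0 := fun h => hx0 (wt_eq_zero h)
      omega
  omega

open Classical in
lemma exists_two {r : ℕ} (h : r = 2 ∨ r = 3 ∨ r = 5) {C : Submodule (ZMod 2) (V (2 * r))}
    (hr : Module.finrank (ZMod 2) C = r)
    (ho : ∀ x ∈ C, ∀ y ∈ C, ∑ i, (x * y) i = 0) : ∃ x ∈ C, wt x = 2 := by
  by_contra! h2
  have h1 := one_mem hr ho
  have hc : (Finset.univ.filter (· ∈ C)).card = 2 ^ r := by
    have := Module.card_eq_pow_finrank (K := ZMod 2) (V := C)
    rw [hr, ZMod.card] at this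
    rw [← this, ← Fintype.card_subtype]
  have small : r = 2 ∨ r = 3 → False := by
    intro hr'
    have hsub : Finset.univ.filter (· ∈ C) ⊆ ({0, 1} : Finset (V (2 * r))) := by
      intro x hx
      simp only [Finset.mem_filter, Finset.mem_univ, true_and] at hx
      have hev := two_dvd_wt (ho x hx x hx)
      rw [mul_self] at hev
      have a := wt_compl x
      have b := h2 _ (C.add_mem hx h1)
      have c := h2 _ hx
      have : wt x = 0 ∨ wt (x + 1) = 0 := by omega
      rcases this with h | h
      · simp [wt_eq_zero h]
      · have h := wt_eq_zero h
        have : x = 1 := by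
          calc x = x + 1 + 1 := by rw [add_assoc, add_self, add_zero]
            _ = 1 := by rw [h, zero_add]
        simp [this]
    have := (Finset.card_le_card hsub).trans Finset.card_le_two
    rw [hc] at this
    rcases hr' with rfl | rfl <;> omega
  rcases h with h | h | h
  · exact small (Or.inl h)
  · exact small (Or.inr h)
  · subst h
    exact no_ten hc ho h1 h2

end S19

/-- for r ∈ {2, 3, 5}, no matrix in ℳ_r is irreducible. -/
theorem stmt19 (r : ℕ) (h : r = 2 ∨ r = 3 ∨ r = 5)
    (A : Matrix (Fin (2*r)) (Fin r) (ZMod 2)) (hA : MemM r A) :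
    ¬ IrredMat A := by
  obtain ⟨hrk, hcol⟩ := hA
  have hr : Module.finrank (ZMod 2) (colSpan A) = r := by
    rw [Matrix.rank_eq_finrank_span_cols] at hrk
    exact hrk
  have ho : ∀ x ∈ colSpan A, ∀ y ∈ colSpan A, ∑ i, (x * y) i = 0 := by
    intro x hx y hy
    show x * y ∈ VS (2 * r)
    unfold colSpan at hx hy
    induction hx using Submodule.span_induction with
    | zero => rw [zero_mul]; exact Submodule.zero_mem _
    | add a b _ _ ha hb => rw [add_mul]; exact Submodule.add_mem _ ha hb
    | smul c a _ ha => rw [smul_mul_assoc]; exact Submodule.smul_mem _ _ ha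
    | mem a ha =>
      obtain ⟨j, rfl⟩ := ha
      induction hy using Submodule.span_induction with
      | zero => rw [mul_zero]; exact Submodule.zero_mem _
      | add a b _ _ ha hb => rw [mul_add]; exact Submodule.add_mem _ ha hb
      | smul c a _ ha => rw [mul_smul_comm]; exact Submodule.smul_mem _ _ ha
      | mem b hb =>
        obtain ⟨k, rfl⟩ := hb
        exact hcol j k
  obtain ⟨x, hx, hw⟩ := S19.exists_two h hr ho
  have hsp := fun y (hy : y ∈ colSpan A) => S19.split ho hx hw hy
  generalize hC : colSpan A = C at hr ho hx hsp
  have hxx := S19.add_self x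
  have hx0 : x ≠ 0 := by
    rintro rfl
    rw [S19.wt_zero] at hw
    omega
  let K : Submodule (ZMod 2) (Fin (2*r) → ZMod 2) := C ⊓ LinearMap.ker (LinearMap.mulLeft (ZMod 2) x)
  have hK : ∀ y, y ∈ K ↔ y ∈ C ∧ x * y = 0 := fun y => Iff.rfl
  let L : Submodule (ZMod 2) (Fin (2*r) → ZMod 2) := Submodule.span (ZMod 2) {x}
  have hL : ∀ y, y ∈ L ↔ ∃ c : ZMod 2, c • x = y := fun y => Submodule.mem_span_singleton
  have hLC : L ≤ C := (Submodule.span_singleton_le_iff_mem _ _).2 hx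
  have hsup : L ⊔ K = C := by
    refine le_antisymm (sup_le hLC inf_le_left) fun y hy => ?_
    rcases hsp y hy with h | h
    · exact Submodule.mem_sup_right ((hK y).2 ⟨hy, h⟩)
    · refine Submodule.mem_sup.2 ⟨x, Submodule.mem_span_singleton_self x, x + y,
        (hK _).2 ⟨C.add_mem hx hy, h⟩, ?_⟩
      rw [← add_assoc, hxx, zero_add]
  have hmul : ∀ a ∈ L, ∀ b ∈ K, a * b = 0 := by
    intro a ha b hb
    obtain ⟨c, rfl⟩ := (hL a).1 ha
    rw [smul_mul_assoc, ((hK b).1 hb).2, smul_zero]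
  have hdis : Disjoint L K := by
    rw [Submodule.disjoint_def]
    intro a ha hb
    have := hmul a ha a hb
    rwa [S19.mul_self] at this
  have hLb : L ≠ ⊥ := by
    intro e
    exact hx0 (Submodule.span_singleton_eq_bot.1 e)
  have hKb : K ≠ ⊥ := by
    intro e
    rw [e, sup_bot_eq] at hsup
    have : Module.finrank (ZMod 2) L = 1 := finrank_span_singleton hx0
    rw [hsup] at this
    omega
  intro hirr
  apply hirr
  refine ⟨2, ![L, K], by norm_num, ?_, ?_, ?_, ?_⟩
  · intro i
    fin_cases i
    · exact hLb
    · exact hKb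
  · intro i j hij
    fin_cases i <;> fin_cases j
    · exact absurd rfl hij
    · exact hmul
    · intro a ha b hb
      exact (mul_comm a b).trans (hmul b hb a ha)
    · exact absurd rfl hij
  · rw [hC, ← hsup]
    apply le_antisymm
    · refine iSup_le fun i => ?_
      fin_cases i
      · exact le_sup_left
      · exact le_sup_right
    · exact sup_le (le_iSup ![L, K] 0) (le_iSup ![L, K] 1)
  · intro i
    fin_cases i
    · refine hdis.mono_right (iSup₂_le fun j hj => ?_)
      fin_cases j
      · exact absurd rfl hj
      · exact le_rfl
    · refine hdis.symm.mono_right (iSup₂_le fun j hj => ?_)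
      fin_cases j
      · exact le_rfl
      · exact absurd rfl hj
end
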